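/- arXiv:2002.00234 — 2 statements merged into one kernel-verified Lean document; each statement's English description precedes it below -/
import Mathlib

section
/- Let P : (−1, 1) × ℝ × (−δ, δ) → ℝ be smooth with P(ε, θ + 2π, I) = P(ε, θ, I) for all (ε, θ, I) and with P(0, θ, I) = p(θ, I) = b₀ + g(I)² (a smooth deformation of p). Then there exist ε₀ > 0, δ' ∈ (0, δ], a smooth map φ : (−ε₀, ε₀) × ℝ × (−δ', δ') → ℝ × (−δ, δ), a smooth map G : (−ε₀, ε₀) × (−δ', δ') → ℝ, and a smooth map W : (−ε₀, ε₀) × ℝ → ℝ with W(ε, θ + 2π) = W(ε, θ), such that: (i) for each ε, the map φ_ε := φ(ε, ·, ·) satisfies φ_ε(θ + 2π, I) = φ_ε(θ, I) + (2π, 0), is injective on [0, 2π) × (−δ', δ'), and has Jacobian determinant identically equal to 1 (it is a symplectic change of variables); (ii) φ₀(θ, I) = (θ, I); (iii) G(0, I) = g(I) for all I ∈ (−δ', δ') and G(ε, 0) = 0 for all ε; (iv) for every N ∈ ℕ and every compact set K ⊂ ℝ × (−δ', δ') there is C > 0 such that |P(ε, φ_ε(θ, I)) − b₀ − G(ε,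 I)² − ε · W(ε, θ)| ≤ C |ε|^N for all (θ, I) ∈ K and all |ε| < ε₀. In other words, in suitable symplectic coordinates the deformation equals b₀ + (g_ε(I))² + ε V_ε(θ) up to an O(ε^∞) error. -/
open Real Set

theorem contDiff_nat_parametric_integral {E : Type} [NormedAddCommGroup E] [NormedSpace ℝ E]
    [FiniteDimensional ℝ E] (n : ℕ) : ∀ {F : Type} [NormedAddCommGroup F] [NormedSpace ℝ F]
    [CompleteSpace F] {f : ℝ × E → F}, ContDiff ℝ n f →
    ContDiff ℝ n fun x => ∫ t in (0 : ℝ)..1, f (t, x) := by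
  induction n with
  | zero =>
    intro F _ _ _ f hf
    have hf' : Continuous f := hf.continuous
    exact contDiff_zero.2 (intervalIntegral.continuous_parametric_intervalIntegral_of_continuous'
      (f := fun x t => f (t, x)) (by unfold Function.uncurry; fun_prop) 0 1)
  | succ n ih =>
    intro F _ _ _ f hf
    have hfc : Continuous f := hf.continuous
    have hfd : Differentiable ℝ f := hf.differentiable (by simp)
    set L := ContinuousLinearMap.inr ℝ ℝ E
    set f' : ℝ × E → E →L[ℝ] F := fun z => (fderiv ℝ f z).comp L
    have hf' : ContDiff ℝ n f' :=
      (hf.fderiv_right (m := n) (by simp)).clm_comp contDiff_const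
    have hfc' : Continuous f' := hf'.continuous
    have hd : ∀ x, HasFDerivAt (fun x => ∫ t in (0 : ℝ)..1, f (t, x))
        (∫ t in (0 : ℝ)..1, f' (t, x)) x := by
      intro x
      obtain ⟨C, hC⟩ := ((isCompact_Icc (a := (0 : ℝ)) (b := 1)).prod
        (isCompact_closedBall x 1)).exists_bound_of_continuousOn hfc'.continuousOn
      refine intervalIntegral.hasFDerivAt_integral_of_dominated_of_fderiv_le
        (F' := fun x t => f' (t, x)) (bound := fun _ => C)
        (Metric.closedBall_mem_nhds x one_pos) ?_ ?_ ?_ ?_ ?_ ?_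
      · exact .of_forall fun y => (by fun_prop : Continuous fun t => f (t, y)).aestronglyMeasurable
      · exact (by fun_prop : Continuous fun t => f (t, x)).intervalIntegrable _ _
      · exact (by fun_prop : Continuous fun t => f' (t, x)).aestronglyMeasurable
      · refine .of_forall fun t ht y hy => hC (t, y) ⟨?_, hy⟩
        rw [uIoc_of_le zero_le_one] at ht
        exact Ioc_subset_Icc_self ht
      · exact intervalIntegrable_const
      · refine .of_forall fun t _ y _ => ?_
        have := (hfd (t, y)).hasFDerivAt.comp y (hasFDerivAt_prodMk_right t y)
        exact this
    rw [show ((n + 1 : ℕ) : WithTop ℕ∞) = n + 1 by norm_cast, contDiff_succ_iff_fderiv]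
    refine ⟨fun x => (hd x).differentiableAt, by simp, ?_⟩
    rw [show fderiv ℝ (fun x => ∫ t in (0 : ℝ)..1, f (t, x)) = _ from
      funext fun x => (hd x).fderiv]
    exact ih hf'

theorem ContDiff.parametric_integral {E F : Type} [NormedAddCommGroup E] [NormedSpace ℝ E]
    [FiniteDimensional ℝ E] [NormedAddCommGroup F] [NormedSpace ℝ F] [CompleteSpace F]
    {f : ℝ × E → F} (hf : ContDiff ℝ (⊤ : ℕ∞) f) :
    ContDiff ℝ (⊤ : ℕ∞) fun x => ∫ t in (0 : ℝ)..1, f (t, x) :=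
  contDiff_infty.2 fun n => contDiff_nat_parametric_integral n (contDiff_infty.1 hf n)

/-- Hadamard's lemma: the difference quotient of a smooth function is smooth. -/
theorem exists_contDiff_differenceQuotient {E : Type} [NormedAddCommGroup E] [NormedSpace ℝ E]
    [FiniteDimensional ℝ E] {f : E → ℝ} (hf : ContDiff ℝ (⊤ : ℕ∞) f) :
    ∃ H : ℝ × E × E → ℝ, ContDiff ℝ (⊤ : ℕ∞) H ∧
      (∀ s x v, f (x + s • v) = f x + s * H (s, x, v)) ∧
      (∀ x v, H (0, x, v) = fderiv ℝ f x v) ∧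
      (∀ p s x v, (∀ y, f (y + p) = f y) → H (s, x + p, v) = H (s, x, v)) := by
  have hfd : Differentiable ℝ f := hf.differentiable (by simp)
  have hf' : ContDiff ℝ (⊤ : ℕ∞) (fderiv ℝ f) := hf.fderiv_right (by simp)
  refine ⟨fun z => ∫ t in (0 : ℝ)..1, fderiv ℝ f (z.2.1 + (t * z.1) • z.2.2) z.2.2, ?_, ?_, ?_, ?_⟩
  · refine ContDiff.parametric_integral
      (f := fun w : ℝ × ℝ × E × E => fderiv ℝ f (w.2.2.1 + (w.1 * w.2.1) • w.2.2.2) w.2.2.2) ?_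
    exact (hf'.comp (by fun_prop)).clm_apply (by fun_prop)
  · intro s x v
    have hd : ∀ t ∈ uIcc (0 : ℝ) 1, HasDerivAt (fun t : ℝ => f (x + (t * s) • v))
        (s * fderiv ℝ f (x + (t * s) • v) v) t := by
      intro t _
      have h1 : HasDerivAt (fun t : ℝ => x + (t * s) • v) (s • v) t := by
        simpa using (((hasDerivAt_id t).mul_const s).smul_const v).const_add x
      have := (hfd (x + (t * s) • v)).hasFDerivAt.comp_hasDerivAt t h1
      rwa [map_smul, smul_eq_mul] at this
    have hc : Continuous fun t : ℝ => s * fderiv ℝ f (x + (t * s) • v) v := by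
      have := hf'.continuous
      fun_prop
    have := intervalIntegral.integral_eq_sub_of_hasDerivAt hd (hc.intervalIntegrable 0 1)
    rw [intervalIntegral.integral_const_mul] at this
    simp only [one_mul, zero_mul, zero_smul, add_zero] at this
    linarith
  · intro x v
    simp
  · intro p s x v hp
    have h : ∀ y, fderiv ℝ f (y + p) = fderiv ℝ f y := by
      intro y
      rw [← fderiv_comp_add_right]
      simp only [hp]
    have h2 : ∀ t : ℝ, fderiv ℝ f (x + p + (t * s) • v) = fderiv ℝ f (x + (t * s) • v) := by
      intro t
      rw [← h (x + _), add_right_comm]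
    simp only [h2]

/-- A smooth function vanishing on `{0} × E` is divisible by the first coordinate. -/
theorem exists_contDiff_eq_fst_mul {E : Type} [NormedAddCommGroup E] [NormedSpace ℝ E]
    [FiniteDimensional ℝ E] {f : ℝ × E → ℝ} (hf : ContDiff ℝ (⊤ : ℕ∞) f)
    (h0 : ∀ x, f (0, x) = 0) :
    ∃ q : ℝ × E → ℝ, ContDiff ℝ (⊤ : ℕ∞) q ∧ ∀ z, f z = z.1 * q z := by
  obtain ⟨H, hH, hH', -, -⟩ := exists_contDiff_differenceQuotient hf
  refine ⟨fun z => H (z.1, (0, z.2), (1, 0)), hH.comp (by fun_prop), fun z => ?_⟩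
  have := hH' z.1 (0, z.2) (1, 0)
  simpa [h0] using this

theorem contDiff_mul_of_tsupport_subset {E : Type} [NormedAddCommGroup E] [NormedSpace ℝ E]
    {U : Set E} (hU : IsOpen U) {c f : E → ℝ} (hc : ContDiff ℝ (⊤ : ℕ∞) c)
    (hf : ContDiffOn ℝ (⊤ : ℕ∞) f U) (h : tsupport c ⊆ U) :
    ContDiff ℝ (⊤ : ℕ∞) fun x => c x * f x := by
  rw [contDiff_iff_contDiffAt]
  intro x
  by_cases hx : x ∈ tsupport c
  · exact hc.contDiffAt.mul (hf.contDiffAt (hU.mem_nhds (h hx)))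
  · refine (contDiffAt_const (c := (0 : ℝ))).congr_of_eventuallyEq ?_
    filter_upwards [(notMem_tsupport_iff_eventuallyEq.1 hx)] with y hy
    simp [hy]
theorem exists_cutoff_iteratedFDeriv_le {E : Type} [NormedAddCommGroup E] [NormedSpace ℝ E]
    [FiniteDimensional ℝ E] {c : ℝ → ℝ} (hc : ContDiff ℝ (⊤ : ℕ∞) c) (hcs : HasCompactSupport c)
    {h : E → ℝ} (hh : ContDiff ℝ (⊤ : ℕ∞) h) (hhs : HasCompactSupport h)
    {j k : ℕ} (hk : k < j) {η : ℝ} (hη : 0 < η) :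
    ∀ᶠ l : ℝ in Filter.atTop, ∀ z : ℝ × E,
      ‖iteratedFDeriv ℝ k (fun z : ℝ × E => z.1 ^ j * c (l * z.1) * h z.2) z‖ ≤ η := by
  set B : ℝ × E → ℝ := fun z => z.1 ^ j * c z.1 * h z.2
  have hB : ContDiff ℝ (⊤ : ℕ∞) B := by
    have h1 := hc.comp (contDiff_fst (E := ℝ) (F := E))
    have h2 := hh.comp (contDiff_snd (E := ℝ) (F := E))
    exact ((contDiff_fst.pow j).mul h1).mul h2
  have hBs : HasCompactSupport B := by
    refine HasCompactSupport.of_support_subset_isCompact (hcs.isCompact.prod hhs.isCompact) ?_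
    intro z hz
    have hz' : z.1 ^ j * c z.1 * h z.2 ≠ 0 := hz
    refine ⟨subset_tsupport _ ?_, subset_tsupport _ ?_⟩
    · exact right_ne_zero_of_mul (left_ne_zero_of_mul hz')
    · exact right_ne_zero_of_mul hz'
  obtain ⟨C, hC⟩ := (hBs.iteratedFDeriv (𝕜 := ℝ) k).exists_bound_of_continuous
    (hB.continuous_iteratedFDeriv (m := k) (mod_cast le_top))
  have hC0 : 0 ≤ C := (norm_nonneg _).trans (hC 0)
  filter_upwards [Filter.eventually_ge_atTop 1, Filter.eventually_ge_atTop (C / η)] with l hl hl' z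
  have hl0 : 0 < l := by linarith
  set L : ℝ × E →L[ℝ] ℝ × E :=
    (l • ContinuousLinearMap.fst ℝ ℝ E).prod (ContinuousLinearMap.snd ℝ ℝ E)
  have hL : ‖L‖ ≤ l := by
    refine L.opNorm_le_bound hl0.le fun x => ?_
    have h1 : L x = (l * x.1, x.2) := rfl
    rw [h1, Prod.norm_mk]
    refine max_le ?_ ?_
    · rw [norm_mul, Real.norm_of_nonneg hl0.le]
      gcongr
      exact norm_fst_le x
    · exact (norm_snd_le x).trans (le_mul_of_one_le_left (norm_nonneg x) hl)
  have hfun : (fun z : ℝ × E => z.1 ^ j * c (l * z.1) * h z.2) =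
      fun z => (l ^ j)⁻¹ • (B ∘ L) z := by
    funext z
    have h1 : L z = (l * z.1, z.2) := rfl
    simp only [Function.comp_apply, h1, B, smul_eq_mul, mul_pow]
    field_simp
  have hBL : ContDiff ℝ (⊤ : ℕ∞) (B ∘ L) := hB.comp L.contDiff
  rw [hfun, iteratedFDeriv_const_smul_apply' (hBL.contDiffAt.of_le (mod_cast le_top)), norm_smul,
    L.iteratedFDeriv_comp_right hB z (i := k) (mod_cast le_top)]
  have h1 := (iteratedFDeriv ℝ k B (L z)).norm_compContinuousLinearMap_le fun _ => L
  rw [Finset.prod_const, Finset.card_univ, Fintype.card_fin] at h1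
  have h2 : ‖L‖ ^ k ≤ l ^ k := pow_le_pow_left₀ (norm_nonneg _) hL k
  have h3 : l ^ k * l ≤ l ^ j := by
    rw [← pow_succ]
    exact pow_le_pow_right₀ hl hk
  rw [norm_inv, norm_pow, Real.norm_of_nonneg hl0.le, inv_mul_le_iff₀ (by positivity)]
  have h4 : C ≤ l * η := (div_le_iff₀ hη).1 hl'
  calc _ ≤ _ := h1
    _ ≤ C * l ^ k := mul_le_mul (hC _) h2 (by positivity) hC0
    _ ≤ l * η * l ^ k := by gcongr
    _ = (l ^ k * l) * η := by ring
    _ ≤ l ^ j * η := by gcongr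

/-- Borel's lemma with parameters, with an explicit form of the sum. -/
theorem exists_borel_sum {E : Type} [NormedAddCommGroup E] [NormedSpace ℝ E]
    [FiniteDimensional ℝ E] {f : ℕ → E → ℝ} (hf : ∀ j, ContDiff ℝ (⊤ : ℕ∞) (f j)) :
    ∃ w : ℕ → ℝ → ℝ, (∀ ε, {j | w j ε ≠ 0}.Finite) ∧
      ContDiff ℝ (⊤ : ℕ∞) (fun z : ℝ × E => ∑' j, w j z.1 * f j z.2) ∧
      ∀ N, ∃ q : ℝ × E → ℝ, ContDiff ℝ (⊤ : ℕ∞) q ∧ ∀ z : ℝ × E,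
        ∑' j, w j z.1 * f j z.2 = ∑ j ∈ Finset.range N, z.1 ^ j * f j z.2 + z.1 ^ N * q z := by
  let c : ContDiffBump (0 : ℝ) := ⟨1, 2, one_pos, one_lt_two⟩
  have hc : ContDiff ℝ (⊤ : ℕ∞) c := c.contDiff
  let ρ : (R : ℕ) → ContDiffBump (0 : E) := fun R => ⟨R + 1, R + 2, by positivity, by linarith⟩
  have hρ : ∀ R j, ContDiff ℝ (⊤ : ℕ∞) fun x => ρ R x * f j x :=
    fun R j => (ρ R).contDiff.mul (hf j)
  have hρs : ∀ R j, HasCompactSupport fun x => ρ R x * f j x :=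
    fun R j => (ρ R).hasCompactSupport.mul_right
  have hex : ∀ i : ℕ, ∃ l : ℝ, (i : ℝ) ≤ l ∧ ∀ j ∈ Finset.range (i + 1), ∀ k ∈ Finset.range j,
      ∀ R ∈ Finset.range (i + 1), ∀ z : ℝ × E,
      ‖iteratedFDeriv ℝ k (fun z : ℝ × E => z.1 ^ j * c (l * z.1) * (ρ R z.2 * f i z.2)) z‖
        ≤ (1 / 2) ^ i := by
    intro i
    refine ((Filter.eventually_ge_atTop (i : ℝ)).and ?_).exists
    simp only [Filter.eventually_all_finset]
    intro j _ k hk R _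
    exact exists_cutoff_iteratedFDeriv_le hc c.hasCompactSupport (hρ R i) (hρs R i)
      (Finset.mem_range.1 hk) (by positivity)
  choose l hl hbound using hex
  set w : ℕ → ℝ → ℝ := fun j ε => ε ^ j * c (l j * ε)
  have hfin : ∀ ε, {j | w j ε ≠ 0}.Finite := by
    intro ε
    rcases eq_or_ne ε 0 with rfl | hε
    · refine (Set.finite_singleton 0).subset fun j hj => ?_
      by_contra h0
      exact hj (by simp [w, zero_pow h0])
    · refine (Set.finite_Iio ⌈2 / |ε|⌉₊).subset fun j hj => ?_
      have h1 : c (l j * ε) ≠ 0 := right_ne_zero_of_mul hj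
      have h2 : l j * ε ∈ Metric.ball (0 : ℝ) 2 := by
        have : l j * ε ∈ Function.support c := h1
        rwa [c.support_eq] at this
      rw [mem_ball_zero_iff, Real.norm_eq_abs, abs_mul] at h2
      have h3 : (j : ℝ) * |ε| < 2 := by
        refine lt_of_le_of_lt ?_ h2
        gcongr
        exact (hl j).trans (le_abs_self _)
      have h4 : (j : ℝ) < 2 / |ε| := (lt_div_iff₀ (abs_pos.2 hε)).2 h3
      exact Nat.lt_ceil.2 h4
  have hT : ∀ p : ℕ, ContDiff ℝ (⊤ : ℕ∞)
      fun z : ℝ × E => ∑' j : ℕ, z.1 ^ j * c (l (j + p) * z.1) * f (j + p) z.2 := by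
    intro p
    rw [contDiff_iff_contDiffAt]
    intro z₀
    obtain ⟨R, hR⟩ := exists_nat_ge ‖z₀.2‖
    have hs : ContDiff ℝ (⊤ : ℕ∞) fun z : ℝ × E =>
        ∑' j : ℕ, z.1 ^ j * c (l (j + p) * z.1) * (ρ R z.2 * f (j + p) z.2) := by
      refine contDiff_tsum_of_eventually (v := fun _ j => (1 / 2 : ℝ) ^ j) (fun j => ?_)
        (fun k _ => summable_geometric_two) (fun k _ => ?_)
      · have h1 : ContDiff ℝ (⊤ : ℕ∞) fun z : ℝ × E => c (l (j + p) * z.1) :=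
          hc.comp (contDiff_const.mul contDiff_fst)
        exact ((contDiff_fst.pow j).mul h1).mul ((hρ R (j + p)).comp contDiff_snd)
      · rw [Nat.cofinite_eq_atTop]
        filter_upwards [Filter.eventually_gt_atTop k, Filter.eventually_ge_atTop R] with j hj hj' z
        refine (hbound (j + p) j ?_ k ?_ R ?_ z).trans ?_
        · simp
        · simpa using hj
        · simp; omega
        · exact pow_le_pow_of_le_one (by norm_num) (by norm_num) (by omega)
    refine hs.contDiffAt.congr_of_eventuallyEq ?_
    have hopen : {z : ℝ × E | ‖z.2‖ < R + 1} ∈ nhds z₀ :=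
      (isOpen_lt (by fun_prop) (by fun_prop)).mem_nhds (by show ‖z₀.2‖ < R + 1; linarith)
    filter_upwards [hopen] with z hz
    have h1 : ρ R z.2 = 1 := (ρ R).one_of_mem_closedBall (by
      rw [mem_closedBall_zero_iff]; exact le_of_lt hz)
    simp only [h1, one_mul]
  have hk : ∀ a : ℝ, ∀ N : ℕ, ∃ κ : ℝ → ℝ, ContDiff ℝ (⊤ : ℕ∞) κ ∧
      ∀ y, c (a * y) = 1 + y ^ N * κ y := by
    intro a N
    have h0 : ∀ᶠ y in nhds (0 : ℝ), c (a * y) = 1 := by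
      have : Filter.Tendsto (fun y : ℝ => a * y) (nhds 0) (nhds 0) := by
        have h := (by fun_prop : Continuous fun y : ℝ => a * y).tendsto 0
        rwa [mul_zero] at h
      exact this.eventually c.eventuallyEq_one
    refine ⟨fun y => (c (a * y) - 1) / y ^ N, ?_, fun y => ?_⟩
    · rw [contDiff_iff_contDiffAt]
      intro y
      rcases eq_or_ne y 0 with rfl | hy
      · refine (contDiffAt_const (c := (0 : ℝ))).congr_of_eventuallyEq ?_
        filter_upwards [h0] with y hy
        simp [hy]
      · have h1 : ContDiff ℝ (⊤ : ℕ∞) fun y => c (a * y) :=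
          hc.comp (contDiff_const.mul contDiff_id)
        exact (h1.contDiffAt.sub contDiffAt_const).div (contDiffAt_id.pow N) (pow_ne_zero _ hy)
    · rcases eq_or_ne y 0 with rfl | hy
      · have h1 : c 0 = 1 := c.eventuallyEq_one.self_of_nhds
        simp [h1]
      · field_simp
        ring
  have hsum : ∀ z : ℝ × E, Summable fun j => w j z.1 * f j z.2 := fun z =>
    summable_of_hasFiniteSupport ((hfin z.1).subset fun j hj => left_ne_zero_of_mul hj)
  refine ⟨w, hfin, by simpa [w] using hT 0, fun N => ?_⟩
  choose κ hκ hκ' using fun j => hk (l j) N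
  refine ⟨fun z => ∑ j ∈ Finset.range N, z.1 ^ j * κ j z.1 * f j z.2 +
    ∑' j : ℕ, z.1 ^ j * c (l (j + N) * z.1) * f (j + N) z.2, ?_, fun z => ?_⟩
  · refine ContDiff.add (ContDiff.sum fun j _ => ?_) (hT N)
    exact ((contDiff_fst.pow j).mul ((hκ j).comp contDiff_fst)).mul ((hf j).comp contDiff_snd)
  · rw [← (hsum z).sum_add_tsum_nat_add N, mul_add, ← tsum_mul_left, Finset.mul_sum, ← add_assoc,
      ← Finset.sum_add_distrib]
    congr 1
    · refine Finset.sum_congr rfl fun j _ => ?_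
      simp only [w, hκ']
      ring
    · refine tsum_congr fun j => ?_
      simp only [w]
      ring

/-- The partial derivative in the angle of a function of `(ε, θ, I)`. -/
noncomputable def angleDeriv (F : ℝ × ℝ × ℝ → ℝ) (z : ℝ × ℝ × ℝ) : ℝ := fderiv ℝ F z (0, 1, 0)

/-- The partial derivative in the action of a function of `(ε, θ, I)`. -/
noncomputable def actionDeriv (F : ℝ × ℝ × ℝ → ℝ) (z : ℝ × ℝ × ℝ) : ℝ := fderiv ℝ F z (0, 0, 1)

theorem contDiff_angleDeriv {F : ℝ × ℝ × ℝ → ℝ} (hF : ContDiff ℝ (⊤ : ℕ∞) F) :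
    ContDiff ℝ (⊤ : ℕ∞) (angleDeriv F) :=
  (hF.fderiv_right (by simp)).clm_apply contDiff_const

theorem contDiff_actionDeriv {F : ℝ × ℝ × ℝ → ℝ} (hF : ContDiff ℝ (⊤ : ℕ∞) F) :
    ContDiff ℝ (⊤ : ℕ∞) (actionDeriv F) :=
  (hF.fderiv_right (by simp)).clm_apply contDiff_const

theorem hasDerivAt_angleDeriv {F : ℝ × ℝ × ℝ → ℝ} (hF : Differentiable ℝ F) (ε θ I : ℝ) :
    HasDerivAt (fun t => F (ε, t, I)) (angleDeriv F (ε, θ, I)) θ := by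
  have h : HasDerivAt (fun t : ℝ => (ε, t, I)) ((0 : ℝ), (1 : ℝ), (0 : ℝ)) θ :=
    (hasDerivAt_const θ ε).prodMk ((hasDerivAt_id θ).prodMk (hasDerivAt_const θ I))
  exact (hF (ε, θ, I)).hasFDerivAt.comp_hasDerivAt θ h

theorem hasDerivAt_actionDeriv {F : ℝ × ℝ × ℝ → ℝ} (hF : Differentiable ℝ F) (ε θ I : ℝ) :
    HasDerivAt (fun t => F (ε, θ, t)) (actionDeriv F (ε, θ, I)) I := by
  have h : HasDerivAt (fun t : ℝ => (ε, θ, t)) ((0 : ℝ), (0 : ℝ), (1 : ℝ)) I :=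
    (hasDerivAt_const I ε).prodMk ((hasDerivAt_const I θ).prodMk (hasDerivAt_id I))
  exact (hF (ε, θ, I)).hasFDerivAt.comp_hasDerivAt I h

theorem fderiv_add_fst_pow_mul_apply {F f : ℝ × ℝ × ℝ → ℝ} (hF : Differentiable ℝ F)
    (hf : Differentiable ℝ f) (N : ℕ) (z : ℝ × ℝ × ℝ) (v : ℝ × ℝ) :
    fderiv ℝ (fun z => F z + z.1 ^ N * f z) z (0, v) =
      fderiv ℝ F z (0, v) + z.1 ^ N * fderiv ℝ f z (0, v) := by
  have h1 : HasFDerivAt (fun z : ℝ × ℝ × ℝ => z.1 ^ N) _ z :=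
    (hasFDerivAt_fst (𝕜 := ℝ) (p := z)).pow N
  have h := (hF z).hasFDerivAt.add (h1.mul (hf z).hasFDerivAt)
  have h2 : fderiv ℝ (fun z => F z + z.1 ^ N * f z) z = _ := h.fderiv
  rw [h2]
  simp

theorem angleDeriv_add_two_pi {F : ℝ × ℝ × ℝ → ℝ} (hF : Differentiable ℝ F) {c : ℝ → ℝ}
    (hc : ∀ ε θ I, F (ε, θ + 2 * π, I) = F (ε, θ, I) + c ε) (ε θ I : ℝ) :
    angleDeriv F (ε, θ + 2 * π, I) = angleDeriv F (ε, θ, I) := by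
  have h1 := (hasDerivAt_angleDeriv hF ε (θ + 2 * π) I).comp_add_const θ (2 * π)
  simp only [hc] at h1
  exact h1.unique ((hasDerivAt_angleDeriv hF ε θ I).add_const _)

theorem actionDeriv_add_two_pi {F : ℝ × ℝ × ℝ → ℝ} (hF : Differentiable ℝ F) {c : ℝ → ℝ}
    (hc : ∀ ε θ I, F (ε, θ + 2 * π, I) = F (ε, θ, I) + c ε) (ε θ I : ℝ) :
    actionDeriv F (ε, θ + 2 * π, I) = actionDeriv F (ε, θ, I) := by
  have h1 := hasDerivAt_actionDeriv hF ε (θ + 2 * π) I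
  simp only [hc] at h1
  exact h1.unique ((hasDerivAt_actionDeriv hF ε θ I).add_const _)

/-- The defect, in the mixed variables of the generating function `F`, of the equation saying that
the transformation generated by `F` takes `g(I)² + ε Q` to `(g(I) + ε Γ)² + ε W`. -/
noncomputable def defect (g : ℝ → ℝ) (Q F : ℝ × ℝ × ℝ → ℝ) (Γ W : ℝ × ℝ → ℝ)
    (z : ℝ × ℝ × ℝ) : ℝ :=
  g (z.2.2 + z.1 * angleDeriv F z) ^ 2 + z.1 * Q (z.1, z.2.1, z.2.2 + z.1 * angleDeriv F z) -
    (g z.2.2 + z.1 * Γ (z.1, z.2.2)) ^ 2 - z.1 * W (z.1, z.2.1 + z.1 * actionDeriv F z)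

theorem exists_defect_add_eq {g : ℝ → ℝ} {Q F f : ℝ × ℝ × ℝ → ℝ} {Γ W γ w : ℝ × ℝ → ℝ}
    (hg : ContDiff ℝ (⊤ : ℕ∞) g) (hQ : ContDiff ℝ (⊤ : ℕ∞) Q)
    (hF : ContDiff ℝ (⊤ : ℕ∞) F) (hΓ : ContDiff ℝ (⊤ : ℕ∞) Γ) (hW : ContDiff ℝ (⊤ : ℕ∞) W)
    (hf : ContDiff ℝ (⊤ : ℕ∞) f) (hγ : ContDiff ℝ (⊤ : ℕ∞) γ) (hw : ContDiff ℝ (⊤ : ℕ∞) w)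
    (N : ℕ) :
    ∃ h : ℝ × ℝ × ℝ → ℝ, ContDiff ℝ (⊤ : ℕ∞) h ∧
      (∀ z, defect g Q (fun z => F z + z.1 ^ N * f z) (fun z => Γ z + z.1 ^ N * γ z)
        (fun z => W z + z.1 ^ N * w z) z = defect g Q F Γ W z + z.1 ^ (N + 1) * h z) ∧
      ∀ θ I, h (0, θ, I) = 2 * g I * deriv g I * angleDeriv f (0, θ, I) - 2 * g I * γ (0, I)
        - w (0, θ) := by
  have hFd : Differentiable ℝ F := hF.differentiable (by simp)
  have hfd : Differentiable ℝ f := hf.differentiable (by simp)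
  have hgd : Differentiable ℝ g := hg.differentiable (by simp)
  have hFa := contDiff_angleDeriv hF
  have hFi := contDiff_actionDeriv hF
  have hfa := contDiff_angleDeriv hf
  have hfi := contDiff_actionDeriv hf
  obtain ⟨H₁, hH₁, hH₁', hH₁0, -⟩ := exists_contDiff_differenceQuotient (hg.pow 2)
  obtain ⟨H₂, hH₂, hH₂', -, -⟩ := exists_contDiff_differenceQuotient hQ
  obtain ⟨H₃, hH₃, hH₃', -, -⟩ := exists_contDiff_differenceQuotient hW
  refine ⟨fun z =>
    H₁ (z.1 ^ (N + 1), z.2.2 + z.1 * angleDeriv F z, angleDeriv f z)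
    + z.1 * H₂ (z.1 ^ (N + 1), (z.1, z.2.1, z.2.2 + z.1 * angleDeriv F z), (0, 0, angleDeriv f z))
    - (2 * (g z.2.2 + z.1 * Γ (z.1, z.2.2)) * γ (z.1, z.2.2)
      + z.1 ^ (N + 1) * γ (z.1, z.2.2) ^ 2)
    - (z.1 * H₃ (z.1 ^ (N + 1), (z.1, z.2.1 + z.1 * actionDeriv F z), (0, actionDeriv f z))
      + w (z.1, z.2.1 + z.1 * (actionDeriv F z + z.1 ^ N * actionDeriv f z))), ?_, ?_, ?_⟩
  · have e1 := hH₁.comp (f := fun z : ℝ × ℝ × ℝ =>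
      (z.1 ^ (N + 1), z.2.2 + z.1 * angleDeriv F z, angleDeriv f z)) (by fun_prop)
    have e2 := hH₂.comp (f := fun z : ℝ × ℝ × ℝ => (z.1 ^ (N + 1),
      (z.1, z.2.1, z.2.2 + z.1 * angleDeriv F z), ((0 : ℝ), (0 : ℝ), angleDeriv f z)))
      (by fun_prop)
    have e3 := hH₃.comp (f := fun z : ℝ × ℝ × ℝ => (z.1 ^ (N + 1),
      (z.1, z.2.1 + z.1 * actionDeriv F z), ((0 : ℝ), actionDeriv f z))) (by fun_prop)
    have e4 := hw.comp (f := fun z : ℝ × ℝ × ℝ =>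
      (z.1, z.2.1 + z.1 * (actionDeriv F z + z.1 ^ N * actionDeriv f z))) (by fun_prop)
    have e5 := hγ.comp (f := fun z : ℝ × ℝ × ℝ => (z.1, z.2.2)) (by fun_prop)
    have e6 := hΓ.comp (f := fun z : ℝ × ℝ × ℝ => (z.1, z.2.2)) (by fun_prop)
    have e7 := hg.comp (f := fun z : ℝ × ℝ × ℝ => z.2.2) (by fun_prop)
    simp only [Function.comp_def] at e1 e2 e3 e4 e5 e6 e7
    fun_prop
  · intro z
    have ha : angleDeriv (fun z => F z + z.1 ^ N * f z) z =
        angleDeriv F z + z.1 ^ N * angleDeriv f z := fderiv_add_fst_pow_mul_apply hFd hfd N z _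
    have hi : actionDeriv (fun z => F z + z.1 ^ N * f z) z =
        actionDeriv F z + z.1 ^ N * actionDeriv f z := fderiv_add_fst_pow_mul_apply hFd hfd N z _
    have k1 := hH₁' (z.1 ^ (N + 1)) (z.2.2 + z.1 * angleDeriv F z) (angleDeriv f z)
    have k2 := hH₂' (z.1 ^ (N + 1)) (z.1, z.2.1, z.2.2 + z.1 * angleDeriv F z)
      (0, 0, angleDeriv f z)
    have k3 := hH₃' (z.1 ^ (N + 1)) (z.1, z.2.1 + z.1 * actionDeriv F z) (0, actionDeriv f z)
    simp only [Prod.smul_mk, Prod.mk_add_mk, smul_eq_mul, mul_zero, add_zero] at k1 k2 k3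
    have l1 : z.2.2 + z.1 * (angleDeriv F z + z.1 ^ N * angleDeriv f z) =
        z.2.2 + z.1 * angleDeriv F z + z.1 ^ (N + 1) * angleDeriv f z := by ring
    have l2 : z.2.1 + z.1 * actionDeriv F z + z.1 ^ (N + 1) * actionDeriv f z =
        z.2.1 + z.1 * (actionDeriv F z + z.1 ^ N * actionDeriv f z) := by ring
    rw [l2] at k3
    simp only [defect]
    rw [ha, hi, l1, k1, k2, k3]
    ring
  · intro θ I
    have k : fderiv ℝ (fun x => g x ^ 2) I (angleDeriv f (0, θ, I)) =
        2 * g I * deriv g I * angleDeriv f (0, θ, I) := by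
      have h := ((hgd I).hasDerivAt.pow 2).hasFDerivAt.fderiv
      have h' : fderiv ℝ (fun x => g x ^ 2) I = _ := h
      rw [h']
      simp
      ring
    simp [hH₁0, k]

/-- Solution of the homological equation of the well `g²`. -/
theorem exists_homological_solution {g : ℝ → ℝ} (hg : ContDiff ℝ (⊤ : ℕ∞) g) (hg0 : g 0 = 0)
    (hg' : ∀ I, deriv g I ≠ 0) {A : ℝ × ℝ → ℝ} (hA : ContDiff ℝ (⊤ : ℕ∞) A)
    (hper : ∀ θ I, A (θ + 2 * π, I) = A (θ, I)) :
    ∃ (f : ℝ × ℝ → ℝ) (γ w : ℝ → ℝ) (c : ℝ), ContDiff ℝ (⊤ : ℕ∞) f ∧ ContDiff ℝ (⊤ : ℕ∞) γ ∧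
      ContDiff ℝ (⊤ : ℕ∞) w ∧ (∀ θ I, f (θ + 2 * π, I) = f (θ, I) + c) ∧ γ 0 = 0 ∧
      (∀ θ, w (θ + 2 * π) = w θ) ∧ ∀ θ I,
        A (θ, I) + (2 * g I * deriv g I * deriv (fun t => f (t, I)) θ - 2 * g I * γ I - w θ)
          = 0 := by
  have hgd : Differentiable ℝ g := hg.differentiable (by simp)
  have hg₁ : ContDiff ℝ (⊤ : ℕ∞) (deriv g) := (contDiff_infty_iff_deriv.1 hg).2
  obtain ⟨H, hH, hH', -, hHper⟩ := exists_contDiff_differenceQuotient hA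
  obtain ⟨K, hK, hK', hK0, -⟩ := exists_contDiff_differenceQuotient hg
  set k : ℝ → ℝ := fun I => K (I, 0, 1)
  have hk : ContDiff ℝ (⊤ : ℕ∞) k := hK.comp (by fun_prop)
  have hgk : ∀ I, g I = I * k I := by
    intro I
    have := hK' I 0 1
    simpa [hg0] using this
  have hk0 : ∀ I, k I ≠ 0 := by
    intro I hI
    rcases lt_trichotomy I 0 with h | rfl | h
    · obtain ⟨x, -, hx⟩ := exists_deriv_eq_zero h hgd.continuous.continuousOn
        (by rw [hg0, hgk, hI, mul_zero])
      exact hg' x hx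
    · have h1 : k 0 = fderiv ℝ g 0 1 := hK0 0 1
      rw [fderiv_apply_one_eq_deriv, hI] at h1
      exact hg' 0 h1.symm
    · obtain ⟨x, -, hx⟩ := exists_deriv_eq_zero h hgd.continuous.continuousOn
        (by rw [hg0, hgk I, hI, mul_zero])
      exact hg' x hx
  set a : ℝ × ℝ → ℝ := fun x => -H (x.2, (x.1, 0), (0, 1)) / (2 * k x.2 * deriv g x.2)
  have ha : ContDiff ℝ (⊤ : ℕ∞) a := by
    have e1 := hH.comp (f := fun x : ℝ × ℝ => (x.2, (x.1, (0 : ℝ)), ((0 : ℝ), (1 : ℝ))))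
      (by fun_prop)
    have e2 := hk.comp (contDiff_snd (E := ℝ) (F := ℝ))
    have e3 := hg₁.comp (contDiff_snd (E := ℝ) (F := ℝ))
    exact e1.neg.div ((contDiff_const.mul e2).mul e3)
      fun x => mul_ne_zero (mul_ne_zero two_ne_zero (hk0 _)) (hg' _)
  have haper : ∀ θ I, a (θ + 2 * π, I) = a (θ, I) := by
    intro θ I
    have := hHper (2 * π, 0) I (θ, 0) (0, 1) (fun y => hper y.1 y.2 ▸ by
      congr 1
      ext <;> simp)
    simp only [Prod.mk_add_mk, add_zero] at this
    simp only [a, this]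
  have haA : ∀ θ I, 2 * g I * deriv g I * a (θ, I) = A (θ, 0) - A (θ, I) := by
    intro θ I
    have h1 := hH' I (θ, 0) (0, 1)
    simp only [Prod.smul_mk, Prod.mk_add_mk, smul_eq_mul, mul_zero, add_zero, zero_add,
      mul_one] at h1
    have h2 := hk0 I
    have h3 := hg' I
    rw [h1, hgk]
    simp only [a]
    field_simp
    ring
  set J : ℝ × ℝ → ℝ := fun x => x.1 * ∫ t in (0 : ℝ)..1, a (t * x.1, x.2)
  have hJ : ContDiff ℝ (⊤ : ℕ∞) J :=
    contDiff_fst.mul (ContDiff.parametric_integral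
      (f := fun y : ℝ × ℝ × ℝ => a (y.1 * y.2.1, y.2.2)) (ha.comp (by fun_prop)))
  have hJint : ∀ θ I, J (θ, I) = ∫ t in (0 : ℝ)..θ, a (t, I) := by
    intro θ I
    have := intervalIntegral.mul_integral_comp_mul_right (a := 0) (b := 1)
      (f := fun t => a (t, I)) (c := θ)
    simpa [J] using this
  have hac : ∀ I, Continuous fun t => a (t, I) := fun I => ha.continuous.comp (by fun_prop)
  have hJd : ∀ θ I, HasDerivAt (fun t => J (t, I)) (a (θ, I)) θ := by
    intro θ I
    simp only [hJint]
    exact (hac I).integral_hasStrictDerivAt 0 θ |>.hasDerivAt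
  have hJper : ∀ θ I, J (θ + 2 * π, I) = J (θ, I) + J (2 * π, I) := by
    intro θ I
    have hp : Function.Periodic (fun t => a (t, I)) (2 * π) := fun t => haper t I
    have h1 := hp.intervalIntegral_add_eq 0 θ
    rw [zero_add] at h1
    rw [hJint, hJint, hJint, h1, intervalIntegral.integral_add_adjacent_intervals
      ((hac I).intervalIntegrable _ _) ((hac I).intervalIntegrable _ _)]
  set m : ℝ → ℝ := fun I => J (2 * π, I) / (2 * π)
  have hm : ContDiff ℝ (⊤ : ℕ∞) m := (hJ.comp (by fun_prop)).div_const _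
  refine ⟨fun x => J x + x.1 * (m 0 - m x.2), fun I => deriv g I * (m 0 - m I),
    fun θ => A (θ, 0), 2 * π * m 0, ?_, ?_, ?_, ?_, ?_, ?_, ?_⟩
  · exact hJ.add (contDiff_fst.mul (contDiff_const.sub (hm.comp contDiff_snd)))
  · exact hg₁.mul (contDiff_const.sub hm)
  · exact hA.comp (by fun_prop)
  · intro θ I
    have : J (2 * π, I) = 2 * π * m I := by
      simp only [m]
      field_simp
    simp only [hJper, this]
    ring
  · simp
  · exact fun θ => hper θ 0
  · intro θ I
    have h1 := ((hJd θ I).add ((hasDerivAt_id θ).mul_const (m 0 - m I))).deriv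
    have h2 : deriv (fun t => J (t, I) + t * (m 0 - m I)) θ = a (θ, I) + 1 * (m 0 - m I) := h1
    rw [h2]
    linear_combination haA θ I

/-- A smooth approximate solution: `F` is the generating function, and the defect is divisible by
`ε ^ (N + 1)`. -/
structure IsApproxSolution (g : ℝ → ℝ) (Q : ℝ × ℝ × ℝ → ℝ) (N : ℕ)
    (S : (ℝ × ℝ × ℝ → ℝ) × (ℝ × ℝ → ℝ) × (ℝ × ℝ → ℝ)) : Prop where
  contDiff_fst : ContDiff ℝ (⊤ : ℕ∞) S.1
  contDiff_snd_fst : ContDiff ℝ (⊤ : ℕ∞) S.2.1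
  contDiff_snd_snd : ContDiff ℝ (⊤ : ℕ∞) S.2.2
  quasiperiodic : ∃ c : ℝ → ℝ, ∀ ε θ I, S.1 (ε, θ + 2 * π, I) = S.1 (ε, θ, I) + c ε
  periodic : ∀ ε θ, S.2.2 (ε, θ + 2 * π) = S.2.2 (ε, θ)
  defect_eq : ∃ r : ℝ × ℝ × ℝ → ℝ, ContDiff ℝ (⊤ : ℕ∞) r ∧
    ∀ z, defect g Q S.1 S.2.1 S.2.2 z = z.1 ^ (N + 1) * r z

/-- An admissible coefficient in the expansion of a solution in powers of `ε`. -/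
structure IsCoefficient (t : (ℝ × ℝ → ℝ) × (ℝ → ℝ) × (ℝ → ℝ)) : Prop where
  contDiff_fst : ContDiff ℝ (⊤ : ℕ∞) t.1
  contDiff_snd_fst : ContDiff ℝ (⊤ : ℕ∞) t.2.1
  contDiff_snd_snd : ContDiff ℝ (⊤ : ℕ∞) t.2.2
  quasiperiodic : ∃ c : ℝ, ∀ θ I, t.1 (θ + 2 * π, I) = t.1 (θ, I) + c
  map_zero : t.2.1 0 = 0
  periodic : ∀ θ, t.2.2 (θ + 2 * π) = t.2.2 θ

/-- Adding a term of order `N` in `ε` to an approximate solution. -/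
def addTerm (N : ℕ) (S : (ℝ × ℝ × ℝ → ℝ) × (ℝ × ℝ → ℝ) × (ℝ × ℝ → ℝ))
    (t : (ℝ × ℝ → ℝ) × (ℝ → ℝ) × (ℝ → ℝ)) :
    (ℝ × ℝ × ℝ → ℝ) × (ℝ × ℝ → ℝ) × (ℝ × ℝ → ℝ) :=
  (fun z => S.1 z + z.1 ^ N * t.1 z.2, fun z => S.2.1 z + z.1 ^ N * t.2.1 z.2,
    fun z => S.2.2 z + z.1 ^ N * t.2.2 z.2)

theorem defect_add_two_pi {g : ℝ → ℝ} {Q F : ℝ × ℝ × ℝ → ℝ} {Γ W : ℝ × ℝ → ℝ}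
    (hQ : ∀ ε θ I, Q (ε, θ + 2 * π, I) = Q (ε, θ, I)) (hF : Differentiable ℝ F) {c : ℝ → ℝ}
    (hc : ∀ ε θ I, F (ε, θ + 2 * π, I) = F (ε, θ, I) + c ε)
    (hW : ∀ ε θ, W (ε, θ + 2 * π) = W (ε, θ)) (ε θ I : ℝ) :
    defect g Q F Γ W (ε, θ + 2 * π, I) = defect g Q F Γ W (ε, θ, I) := by
  simp only [defect, angleDeriv_add_two_pi hF hc, actionDeriv_add_two_pi hF hc, hQ,
    show ∀ x, θ + 2 * π + x = θ + x + 2 * π from fun x => by ring, hW]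

theorem eq_of_fst_pow_mul_eq {E : Type} [TopologicalSpace E] {r : ℝ × E → ℝ} (hr : Continuous r)
    {N : ℕ} {x y : E} (h : ∀ ε, ε ^ N * r (ε, x) = ε ^ N * r (ε, y)) (ε : ℝ) :
    r (ε, x) = r (ε, y) := by
  have h1 : EqOn (fun ε => r (ε, x)) (fun ε => r (ε, y)) {0}ᶜ :=
    fun ε hε => mul_left_cancel₀ (pow_ne_zero _ hε) (h ε)
  exact congrFun (Continuous.ext_on (dense_compl_singleton 0) (by fun_prop) (by fun_prop) h1) ε

theorem exists_isApproxSolution_addTerm {g : ℝ → ℝ} {Q : ℝ × ℝ × ℝ → ℝ}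
    (hg : ContDiff ℝ (⊤ : ℕ∞) g) (hg0 : g 0 = 0) (hg' : ∀ I, deriv g I ≠ 0)
    (hQ : ContDiff ℝ (⊤ : ℕ∞) Q) (hQper : ∀ ε θ I, Q (ε, θ + 2 * π, I) = Q (ε, θ, I))
    {N : ℕ} {S : (ℝ × ℝ × ℝ → ℝ) × (ℝ × ℝ → ℝ) × (ℝ × ℝ → ℝ)} (hS : IsApproxSolution g Q N S) :
    ∃ t, IsCoefficient t ∧ IsApproxSolution g Q (N + 1) (addTerm N S t) := by
  obtain ⟨r, hr, hr'⟩ := hS.defect_eq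
  obtain ⟨C, hC⟩ := hS.quasiperiodic
  have hrper : ∀ ε θ I, r (ε, θ + 2 * π, I) = r (ε, θ, I) := by
    intro ε θ I
    refine eq_of_fst_pow_mul_eq hr.continuous (N := N + 1) (fun ε => ?_) ε
    rw [← hr' (ε, _), ← hr' (ε, _)]
    exact defect_add_two_pi hQper (hS.contDiff_fst.differentiable (by simp)) hC hS.periodic ε θ I
  obtain ⟨f, γ, w, c, hf, hγ, hw, hfc, hγ0, hwp, hsol⟩ := exists_homological_solution hg hg0 hg'
    (A := fun x => r (0, x.1, x.2)) (hr.comp (by fun_prop)) (fun θ I => hrper 0 θ I)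
  refine ⟨(f, γ, w), ⟨hf, hγ, hw, ⟨c, hfc⟩, hγ0, hwp⟩, ?_⟩
  have hf₁ : ContDiff ℝ (⊤ : ℕ∞) fun z : ℝ × ℝ × ℝ => f z.2 := hf.comp (by fun_prop)
  have hγ₁ : ContDiff ℝ (⊤ : ℕ∞) fun z : ℝ × ℝ => γ z.2 := hγ.comp (by fun_prop)
  have hw₁ : ContDiff ℝ (⊤ : ℕ∞) fun z : ℝ × ℝ => w z.2 := hw.comp (by fun_prop)
  obtain ⟨h, hh, hh', hh0⟩ := exists_defect_add_eq hg hQ hS.contDiff_fst hS.contDiff_snd_fst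
    hS.contDiff_snd_snd hf₁ hγ₁ hw₁ N
  have hzero : ∀ x : ℝ × ℝ, r (0, x) + h (0, x) = 0 := by
    rintro ⟨θ, I⟩
    have h1 := (hasDerivAt_angleDeriv (hf₁.differentiable (by simp)) 0 θ I).deriv
    rw [hh0, ← h1]
    exact hsol θ I
  obtain ⟨q, hq, hq'⟩ := exists_contDiff_eq_fst_mul (hr.add hh) hzero
  refine ⟨?_, ?_, ?_, ⟨fun ε => C ε + ε ^ N * c, ?_⟩, ?_, q, hq, ?_⟩
  · exact hS.contDiff_fst.add ((contDiff_fst.pow N).mul hf₁)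
  · exact hS.contDiff_snd_fst.add ((contDiff_fst.pow N).mul hγ₁)
  · exact hS.contDiff_snd_snd.add ((contDiff_fst.pow N).mul hw₁)
  · intro ε θ I
    simp only [addTerm, hC, hfc]
    ring
  · intro ε θ
    simp only [addTerm, hS.periodic, hwp]
  · intro z
    have h1 := hh' z
    have h2 : r z + h z = z.1 * q z := hq' z
    simp only [addTerm]
    rw [h1, hr', pow_succ _ (N + 1), mul_assoc, ← h2]
    ring

/-- The normal form up to an error which is divisible by all powers of `ε`. -/
theorem exists_isApproxSolution_forall {g : ℝ → ℝ} {Q : ℝ × ℝ × ℝ → ℝ}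
    (hg : ContDiff ℝ (⊤ : ℕ∞) g) (hg0 : g 0 = 0) (hg' : ∀ I, deriv g I ≠ 0)
    (hQ : ContDiff ℝ (⊤ : ℕ∞) Q) (hQper : ∀ ε θ I, Q (ε, θ + 2 * π, I) = Q (ε, θ, I)) :
    ∃ S : (ℝ × ℝ × ℝ → ℝ) × (ℝ × ℝ → ℝ) × (ℝ × ℝ → ℝ),
      (∀ N, IsApproxSolution g Q N S) ∧ ∀ ε, S.2.1 (ε, 0) = 0 := by
  have hzero : IsApproxSolution g Q 0 (fun _ => 0, fun _ => 0, fun _ => 0) := by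
    refine ⟨contDiff_const, contDiff_const, contDiff_const, ⟨fun _ => 0, by simp⟩, by simp, Q, hQ,
      fun z => ?_⟩
    simp [defect, angleDeriv]
  choose t ht ht' using fun (N : ℕ) (S : {S // IsApproxSolution g Q N S}) =>
    exists_isApproxSolution_addTerm hg hg0 hg' hQ hQper S.2
  let S : (N : ℕ) → {S // IsApproxSolution g Q N S} := fun N =>
    Nat.rec ⟨_, hzero⟩ (fun N S => ⟨_, ht' N S⟩) N
  have hS : ∀ N, (S N).1 = (fun z => ∑ j ∈ Finset.range N, z.1 ^ j * (t j (S j)).1 z.2,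
      fun z => ∑ j ∈ Finset.range N, z.1 ^ j * (t j (S j)).2.1 z.2,
      fun z => ∑ j ∈ Finset.range N, z.1 ^ j * (t j (S j)).2.2 z.2) := by
    intro N
    induction N with
    | zero => rfl
    | succ N ih =>
      have h1 : (S (N + 1)).1 = addTerm N (S N).1 (t N (S N)) := rfl
      rw [h1, ih]
      simp only [addTerm, Finset.sum_range_succ]
  have htc := fun j => ht j (S j)
  obtain ⟨u, hu, hF, hFq⟩ := exists_borel_sum fun j => (htc j).contDiff_fst
  obtain ⟨v, hv, hΓ, hΓq⟩ := exists_borel_sum fun j => (htc j).contDiff_snd_fst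
  obtain ⟨w, hw, hW, hWq⟩ := exists_borel_sum fun j => (htc j).contDiff_snd_snd
  refine ⟨(fun z => ∑' j, u j z.1 * (t j (S j)).1 z.2,
      fun z => ∑' j, v j z.1 * (t j (S j)).2.1 z.2,
      fun z => ∑' j, w j z.1 * (t j (S j)).2.2 z.2), fun N => ⟨hF, hΓ, hW, ?_, ?_, ?_⟩, ?_⟩
  · choose c hc using fun j => (htc j).quasiperiodic
    have hsum : ∀ ε, ∀ a : ℕ → ℝ, Summable fun j => u j ε * a j := fun ε a =>
      summable_of_hasFiniteSupport ((hu ε).subset fun j hj => left_ne_zero_of_mul hj)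
    refine ⟨fun ε => ∑' j, u j ε * c j, fun ε θ I => ?_⟩
    simp only [hc, mul_add]
    exact (hsum _ _).tsum_add (hsum _ _)
  · intro ε θ
    simp only [(htc _).periodic]
  · obtain ⟨q₁, hq₁, hq₁'⟩ := hFq N
    obtain ⟨q₂, hq₂, hq₂'⟩ := hΓq N
    obtain ⟨q₃, hq₃, hq₃'⟩ := hWq N
    have hSN := (S N).2
    rw [hS N] at hSN
    obtain ⟨r, hr, hr'⟩ := hSN.defect_eq
    obtain ⟨h, hh, hh', -⟩ := exists_defect_add_eq hg hQ hSN.contDiff_fst hSN.contDiff_snd_fst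
      hSN.contDiff_snd_snd hq₁ hq₂ hq₃ N
    refine ⟨fun z => r z + h z, hr.add hh, fun z => ?_⟩
    rw [mul_add, ← hr', ← hh']
    simp only [← hq₁', ← hq₂', ← hq₃']
  · intro ε
    simp only [(htc _).map_zero, mul_zero, tsum_zero]

theorem angleDeriv_actionDeriv {F : ℝ × ℝ × ℝ → ℝ} (hF : ContDiff ℝ (⊤ : ℕ∞) F) (z : ℝ × ℝ × ℝ) :
    angleDeriv (actionDeriv F) z = actionDeriv (angleDeriv F) z := by
  have hd : Differentiable ℝ (fderiv ℝ F) :=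
    (hF.fderiv_right (m := (⊤ : ℕ∞)) (by simp)).differentiable (by simp)
  have key : ∀ v w, fderiv ℝ (fun y => fderiv ℝ F y v) z w = fderiv ℝ (fderiv ℝ F) z w v := by
    intro v w
    have h := ((hd z).hasFDerivAt.clm_apply (hasFDerivAt_const v z)).fderiv
    rw [h]
    simp
  have hsymm : IsSymmSndFDerivAt ℝ F z := hF.contDiffAt.isSymmSndFDerivAt
    (by
      rw [minSmoothness_of_isRCLikeNormedField]
      exact WithTop.coe_le_coe.2 (le_top : (2 : ℕ∞) ≤ ⊤))
  have h1 : angleDeriv (actionDeriv F) z = fderiv ℝ (fderiv ℝ F) z (0, 1, 0) (0, 0, 1) := key _ _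
  have h2 : actionDeriv (angleDeriv F) z = fderiv ℝ (fderiv ℝ F) z (0, 0, 1) (0, 1, 0) := key _ _
  rw [h1, h2]
  exact hsymm.eq _ _

theorem ContinuousLinearMap.det_prod (L : ℝ × ℝ →L[ℝ] ℝ × ℝ) :
    L.det = (L (1, 0)).1 * (L (0, 1)).2 - (L (0, 1)).1 * (L (1, 0)).2 := by
  change LinearMap.det (L : ℝ × ℝ →ₗ[ℝ] ℝ × ℝ) = _
  rw [← LinearMap.det_toMatrix (Module.Basis.finTwoProd ℝ), Matrix.det_fin_two]
  simp [LinearMap.toMatrix_apply]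

theorem exists_abs_le_of_periodic {v : ℝ × ℝ × ℝ → ℝ} (hv : Continuous v)
    (hper : ∀ ε θ I, v (ε, θ + 2 * π, I) = v (ε, θ, I)) (d : ℝ) :
    ∃ B, ∀ ε θ I, |ε| ≤ 1 → |I| ≤ d → |v (ε, θ, I)| ≤ B := by
  obtain ⟨B, hB⟩ := ((isCompact_Icc (a := (-1 : ℝ)) (b := 1)).prod
    ((isCompact_Icc (a := 0) (b := 2 * π)).prod
      (isCompact_Icc (a := -d) (b := d)))).exists_bound_of_continuousOn hv.continuousOn
  refine ⟨B, fun ε θ I hε hI => ?_⟩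
  have hp : Function.Periodic (fun t => v (ε, t, I)) (2 * π) := fun t => hper ε t I
  obtain ⟨t, ht, h⟩ := hp.exists_mem_Ico₀ two_pi_pos θ
  have h' : v (ε, θ, I) = v (ε, t, I) := h
  rw [h']
  exact hB (ε, t, I) ⟨abs_le.1 hε, Ico_subset_Icc_self ht, abs_le.1 hI⟩

/-- The inverse of `t ↦ t + ε a(ε, t, I)` depends smoothly on the parameters. -/
theorem exists_contDiffOn_inverse {a : ℝ × ℝ × ℝ → ℝ} (ha : ContDiff ℝ (⊤ : ℕ∞) a) {ε₀ d : ℝ}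
    (h1 : ∀ ε ∈ Ioo (-ε₀) ε₀, ∀ t, ∀ I ∈ Ioo (-d) d, |ε * a (ε, t, I)| ≤ 1)
    (h2 : ∀ ε ∈ Ioo (-ε₀) ε₀, ∀ t, ∀ I ∈ Ioo (-d) d, |ε * angleDeriv a (ε, t, I)| ≤ 1 / 2) :
    ∃ T : ℝ × ℝ × ℝ → ℝ, ContDiffOn ℝ (⊤ : ℕ∞) T (Ioo (-ε₀) ε₀ ×ˢ univ ×ˢ Ioo (-d) d) ∧
      ∀ ε ∈ Ioo (-ε₀) ε₀, ∀ t, ∀ I ∈ Ioo (-d) d,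
        T (ε, t + ε * a (ε, t, I), I) = t ∧
        T (ε, t, I) + ε * a (ε, T (ε, t, I), I) = t := by
  have had : Differentiable ℝ a := ha.differentiable (by simp)
  have hac : Continuous a := ha.continuous
  have hinj : ∀ ε ∈ Ioo (-ε₀) ε₀, ∀ I ∈ Ioo (-d) d,
      Function.Injective fun t => t + ε * a (ε, t, I) := by
    intro ε hε I hI
    refine (strictMono_of_deriv_pos fun t => ?_).injective
    have h := ((hasDerivAt_id t).add ((hasDerivAt_angleDeriv had ε t I).const_mul ε)).deriv
    have h' : deriv (fun t => t + ε * a (ε, t, I)) t = 1 + ε * angleDeriv a (ε, t, I) := h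
    rw [h']
    linarith [(abs_le.1 (h2 ε hε t I hI)).1]
  have hsurj : ∀ ε ∈ Ioo (-ε₀) ε₀, ∀ I ∈ Ioo (-d) d,
      Function.Surjective fun t => t + ε * a (ε, t, I) := by
    intro ε hε I hI
    refine Continuous.surjective (by fun_prop) ?_ ?_
    · exact Filter.tendsto_atTop_mono (fun t => by
        rw [id]; linarith [(abs_le.1 (h1 ε hε t I hI)).1])
        (Filter.tendsto_atTop_add_const_right _ (-1) Filter.tendsto_id)
    · exact Filter.tendsto_atBot_mono (fun t => by
        rw [id]; linarith [(abs_le.1 (h1 ε hε t I hI)).2])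
        (Filter.tendsto_atBot_add_const_right _ 1 Filter.tendsto_id)
  set T : ℝ × ℝ × ℝ → ℝ := fun z =>
    Function.invFun (fun t => t + z.1 * a (z.1, t, z.2.2)) z.2.1
  have hT : ∀ ε ∈ Ioo (-ε₀) ε₀, ∀ t, ∀ I ∈ Ioo (-d) d,
      T (ε, t + ε * a (ε, t, I), I) = t ∧ T (ε, t, I) + ε * a (ε, T (ε, t, I), I) = t :=
    fun ε hε t I hI => ⟨Function.leftInverse_invFun (hinj ε hε I hI) t,
      Function.rightInverse_invFun (hsurj ε hε I hI) t⟩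
  refine ⟨T, fun z hz => ContDiffAt.contDiffWithinAt ?_, hT⟩
  obtain ⟨ε, θ, I⟩ := z
  obtain ⟨hε, -, hI⟩ := hz
  simp only at hε hI
  set p : ℝ × ℝ × ℝ := (ε, T (ε, θ, I), I) with hp
  set Ψ : ℝ × ℝ × ℝ → ℝ × ℝ × ℝ := fun y => (y.1, y.2.1 + y.1 * a y, y.2.2)
  have hΨ : ContDiff ℝ (⊤ : ℕ∞) Ψ := by fun_prop
  have hΨp : Ψ p = (ε, θ, I) := by
    simp only [Ψ, hp]
    rw [(hT ε hε θ I hI).2]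
  have hderiv : ∀ v, fderiv ℝ Ψ p v =
      (v.1, v.2.1 + (p.1 * fderiv ℝ a p v + a p * v.1), v.2.2) := by
    intro v
    have e1 : HasFDerivAt (fun y : ℝ × ℝ × ℝ => y.1) (ContinuousLinearMap.fst ℝ ℝ (ℝ × ℝ)) p :=
      hasFDerivAt_fst
    have e2 : HasFDerivAt (fun y : ℝ × ℝ × ℝ => y.2) (ContinuousLinearMap.snd ℝ ℝ (ℝ × ℝ)) p :=
      hasFDerivAt_snd
    have h := (e1.prodMk ((e2.fst.add (e1.mul (had p).hasFDerivAt)).prodMk e2.snd)).fderiv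
    have h' : fderiv ℝ Ψ p = _ := h
    rw [h']
    rfl
  have hker : Function.Injective (fderiv ℝ Ψ p).toLinearMap := by
    rw [← LinearMap.ker_eq_bot, LinearMap.ker_eq_bot']
    rintro ⟨x, y, w⟩ hv
    have h0 := (hderiv (x, y, w)).symm.trans hv
    simp only [Prod.mk_eq_zero] at h0
    obtain ⟨rfl, h0, rfl⟩ := h0
    have h3 : fderiv ℝ a p (0, y, 0) = y * angleDeriv a p := by
      rw [show ((0 : ℝ), y, (0 : ℝ)) = y • ((0 : ℝ), (1 : ℝ), (0 : ℝ)) by simp, map_smul]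
      rfl
    have h4 := (abs_le.1 (h2 ε hε (T (ε, θ, I)) I hI)).1
    rw [h3] at h0
    have h5 : y * (1 + ε * angleDeriv a p) = 0 := by linear_combination h0
    rcases mul_eq_zero.1 h5 with h6 | h6
    · simp [h6]
    · linarith
  set e : (ℝ × ℝ × ℝ) ≃L[ℝ] (ℝ × ℝ × ℝ) :=
    (LinearEquiv.ofInjectiveEndo _ hker).toContinuousLinearEquiv
  have he : HasFDerivAt Ψ (e : (ℝ × ℝ × ℝ) →L[ℝ] (ℝ × ℝ × ℝ)) p := by
    have h3 : (e : (ℝ × ℝ × ℝ) →L[ℝ] (ℝ × ℝ × ℝ)) = fderiv ℝ Ψ p := by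
      ext <;> rfl
    rw [h3]
    exact (hΨ.differentiable (by simp) p).hasFDerivAt
  have hstrict : HasStrictFDerivAt Ψ (e : (ℝ × ℝ × ℝ) →L[ℝ] (ℝ × ℝ × ℝ)) p :=
    hΨ.contDiffAt.hasStrictFDerivAt' he (by simp)
  have hloc : ContDiffAt ℝ (⊤ : ℕ∞) (hstrict.localInverse Ψ e p) (Ψ p) :=
    hΨ.contDiffAt.to_localInverse he (by simp)
  have hright := hstrict.eventually_right_inverse
  rw [hΨp] at hloc hright
  refine (hloc.snd.fst).congr_of_eventuallyEq ?_
  have hopen : Ioo (-ε₀) ε₀ ×ˢ univ ×ˢ Ioo (-d) d ∈ nhds (ε, θ, I) :=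
    (isOpen_Ioo.prod (isOpen_univ.prod isOpen_Ioo)).mem_nhds ⟨hε, mem_univ _, hI⟩
  filter_upwards [hright, hopen] with z hz hzU
  generalize hstrict.localInverse Ψ e p z = y at hz
  subst hz
  exact (hT y.1 hzU.1 y.2.1 y.2.2 hzU.2.2).1

/-- The symplectic map with generating function `F`: `T` is the old angle as a function of the new
coordinates. -/
theorem exists_symplectic_of_generating {F : ℝ × ℝ × ℝ → ℝ} (hF : ContDiff ℝ (⊤ : ℕ∞) F)
    {c : ℝ → ℝ} (hc : ∀ ε θ I, F (ε, θ + 2 * π, I) = F (ε, θ, I) + c ε) {d : ℝ} (hd : 0 < d) :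
    ∃ (ε₀ : ℝ) (T : ℝ × ℝ × ℝ → ℝ), 0 < ε₀ ∧ ε₀ ≤ 1 / 2 ∧
      ContDiffOn ℝ (⊤ : ℕ∞) T (Ioo (-ε₀) ε₀ ×ˢ univ ×ˢ Ioo (-d) d) ∧
      ∀ ε ∈ Ioo (-ε₀) ε₀,
        (∀ θ, ∀ I ∈ Ioo (-d) d, T (ε, θ + 2 * π, I) = T (ε, θ, I) + 2 * π ∧
          T (ε, θ, I) + ε * actionDeriv F (ε, T (ε, θ, I), I) = θ ∧
          |ε * actionDeriv F (ε, T (ε, θ, I), I)| ≤ 1 ∧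
          |ε * angleDeriv F (ε, T (ε, θ, I), I)| ≤ d ∧
          (fderiv ℝ (fun x : ℝ × ℝ => (T (ε, x.1, x.2),
            x.2 + ε * angleDeriv F (ε, T (ε, x.1, x.2), x.2))) (θ, I)).det = 1) ∧
        InjOn (fun x : ℝ × ℝ => (T (ε, x.1, x.2),
            x.2 + ε * angleDeriv F (ε, T (ε, x.1, x.2), x.2))) (univ ×ˢ Ioo (-d) d) := by
  have hFd : Differentiable ℝ F := hF.differentiable (by simp)
  have ha := contDiff_actionDeriv hF
  have hb := contDiff_angleDeriv hF
  have had : Differentiable ℝ (actionDeriv F) := ha.differentiable (by simp)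
  have hbd : Differentiable ℝ (angleDeriv F) := hb.differentiable (by simp)
  have haper := actionDeriv_add_two_pi hFd hc
  have hbper := angleDeriv_add_two_pi hFd hc
  have habper := angleDeriv_add_two_pi had (c := fun _ => 0) (by simpa using haper)
  obtain ⟨B₁, hB₁⟩ := exists_abs_le_of_periodic ha.continuous haper d
  obtain ⟨B₂, hB₂⟩ := exists_abs_le_of_periodic hb.continuous hbper d
  obtain ⟨B₃, hB₃⟩ := exists_abs_le_of_periodic (contDiff_angleDeriv ha).continuous habper d
  set B := max 1 (max B₁ (max B₂ B₃))
  have hB : 0 < B := lt_of_lt_of_le one_pos (le_max_left _ _)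
  set ε₀ := min (1 / 2) (min (1 / 2) d / B)
  have hm : 0 < min (1 / 2) d := lt_min (by norm_num) hd
  have hε₀ : 0 < ε₀ := lt_min (by norm_num) (div_pos hm hB)
  have hε₀1 : ε₀ ≤ 1 / 2 := min_le_left _ _
  have hsmall : ∀ ε ∈ Ioo (-ε₀) ε₀, ∀ x, |x| ≤ B → |ε * x| ≤ min (1 / 2) d := by
    intro ε hε x hx
    have h1 : |ε| ≤ min (1 / 2) d / B := (abs_lt.2 hε).le.trans (min_le_right _ _)
    rw [abs_mul]
    calc |ε| * |x| ≤ min (1 / 2) d / B * B := by gcongr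
      _ = min (1 / 2) d := by field_simp
  have hε1 : ∀ ε ∈ Ioo (-ε₀) ε₀, |ε| ≤ 1 := fun ε hε =>
    (abs_lt.2 hε).le.trans (hε₀1.trans (by norm_num))
  have hId : ∀ I ∈ Ioo (-d) d, |I| ≤ d := fun I hI => (abs_lt.2 hI).le
  have s1 : ∀ ε ∈ Ioo (-ε₀) ε₀, ∀ t, ∀ I ∈ Ioo (-d) d,
      |ε * actionDeriv F (ε, t, I)| ≤ min (1 / 2) d := fun ε hε t I hI =>
    hsmall ε hε _ ((hB₁ ε t I (hε1 ε hε) (hId I hI)).trans (by simp [B]))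
  have s2 : ∀ ε ∈ Ioo (-ε₀) ε₀, ∀ t, ∀ I ∈ Ioo (-d) d,
      |ε * angleDeriv F (ε, t, I)| ≤ min (1 / 2) d := fun ε hε t I hI =>
    hsmall ε hε _ ((hB₂ ε t I (hε1 ε hε) (hId I hI)).trans (by simp [B]))
  have s3 : ∀ ε ∈ Ioo (-ε₀) ε₀, ∀ t, ∀ I ∈ Ioo (-d) d,
      |ε * angleDeriv (actionDeriv F) (ε, t, I)| ≤ 1 / 2 := fun ε hε t I hI =>
    (hsmall ε hε _ ((hB₃ ε t I (hε1 ε hε) (hId I hI)).trans (by simp [B]))).trans (min_le_left _ _)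
  obtain ⟨T, hT, hT'⟩ := exists_contDiffOn_inverse ha (d := d)
    (fun ε hε t I hI => ((s1 ε hε t I hI).trans (min_le_left _ _)).trans (by norm_num)) s3
  refine ⟨ε₀, T, hε₀, hε₀1, hT, fun ε hε => ⟨fun θ I hI => ⟨?_, (hT' ε hε θ I hI).2, ?_, ?_, ?_⟩,
    ?_⟩⟩
  · have h1 := (hT' ε hε (T (ε, θ, I) + 2 * π) I hI).1
    rw [haper, add_right_comm, (hT' ε hε θ I hI).2] at h1
    exact h1
  · exact ((s1 ε hε _ I hI).trans (min_le_left _ _)).trans (by norm_num)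
  · exact (s2 ε hε _ I hI).trans (min_le_right _ _)
  · set t := T (ε, θ, I)
    set φ : ℝ × ℝ → ℝ × ℝ := fun x => (T (ε, x.1, x.2),
            x.2 + ε * angleDeriv F (ε, T (ε, x.1, x.2), x.2)) with hφ
    set A : ℝ × ℝ → ℝ × ℝ := fun x => (x.1 + ε * actionDeriv F (ε, x), x.2)
    have hAt : A (t, I) = (θ, I) := by
      simp only [A]
      rw [(hT' ε hε θ I hI).2]
    have hTd : DifferentiableAt ℝ T (ε, θ, I) :=
      (hT.contDiffAt ((isOpen_Ioo.prod (isOpen_univ.prod isOpen_Ioo)).mem_nhds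
        ⟨hε, mem_univ _, hI⟩)).differentiableAt (by simp)
    have hφd : DifferentiableAt ℝ φ (A (t, I)) := by
      rw [hAt]
      have h1 : DifferentiableAt ℝ (fun x : ℝ × ℝ => T (ε, x.1, x.2)) (θ, I) :=
        DifferentiableAt.comp (g := T) (f := fun x : ℝ × ℝ => (ε, x.1, x.2)) (θ, I) hTd
          (by fun_prop)
      fun_prop
    have e1 : HasFDerivAt (fun x : ℝ × ℝ => x.1) (ContinuousLinearMap.fst ℝ ℝ ℝ) (t, I) :=
      hasFDerivAt_fst
    have e2 : HasFDerivAt (fun x : ℝ × ℝ => x.2) (ContinuousLinearMap.snd ℝ ℝ ℝ) (t, I) :=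
      hasFDerivAt_snd
    have e3 := hasFDerivAt_prodMk_right (𝕜 := ℝ) ε (t, I)
    have hA := (e1.add (((had (ε, t, I)).hasFDerivAt.comp (t, I) e3).const_mul ε)).prodMk e2
    have hBd := e1.prodMk (e2.add (((hbd (ε, t, I)).hasFDerivAt.comp (t, I) e3).const_mul ε))
    have hcomp := (hφd.hasFDerivAt.comp (t, I) (f := A) hA).congr_of_eventuallyEq
      (f₁ := fun x : ℝ × ℝ => (x.1, x.2 + ε * angleDeriv F (ε, x))) (by
        have hopen : univ ×ˢ Ioo (-d) d ∈ nhds (t, I) :=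
          (isOpen_univ.prod isOpen_Ioo).mem_nhds ⟨mem_univ _, hI⟩
        filter_upwards [hopen] with x hx
        have h1 : T (ε, (A x).1, (A x).2) = x.1 := (hT' ε hε x.1 x.2 hx.2).1
        simp only [Function.comp_apply, hφ, h1]
        rfl)
    have heq := hcomp.unique hBd
    have hdet := congrArg ContinuousLinearMap.det heq
    rw [hAt] at hdet
    have hmul : ∀ L M : ℝ × ℝ →L[ℝ] ℝ × ℝ, (L.comp M).det = L.det * M.det := fun L M =>
      LinearMap.det_comp (L : ℝ × ℝ →ₗ[ℝ] ℝ × ℝ) (M : ℝ × ℝ →ₗ[ℝ] ℝ × ℝ)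
    rw [hmul, ContinuousLinearMap.det_prod (ContinuousLinearMap.prod _ _),
      ContinuousLinearMap.det_prod (ContinuousLinearMap.prod _ _)] at hdet
    have q1 : fderiv ℝ (actionDeriv F) (ε, t, I) (0, 1, 0) =
      angleDeriv (actionDeriv F) (ε, t, I) := rfl
    have q2 : fderiv ℝ (angleDeriv F) (ε, t, I) (0, 0, 1) =
      angleDeriv (actionDeriv F) (ε, t, I) := (angleDeriv_actionDeriv hF _).symm
    simp [q1, q2] at hdet
    have hpos := (abs_le.1 (s3 ε hε t I hI)).1
    have hne : 1 + ε * angleDeriv (actionDeriv F) (ε, t, I) ≠ 0 := by linarith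
    exact mul_right_cancel₀ hne (hdet.trans (one_mul _).symm)
  · rintro ⟨θ₁, I₁⟩ ⟨-, h₁⟩ ⟨θ₂, I₂⟩ ⟨-, h₂⟩ heq
    simp only [Prod.mk.injEq] at heq h₁ h₂
    obtain ⟨ht, hI⟩ := heq
    rw [ht] at hI
    have hmono : StrictMonoOn (fun I => I + ε * angleDeriv F (ε, T (ε, θ₂, I₂), I))
        (Ioo (-d) d) := by
      refine strictMonoOn_of_deriv_pos (convex_Ioo _ _) ?_ fun I hI => ?_
      · have := hb.continuous
        exact Continuous.continuousOn (by fun_prop)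
      · rw [interior_Ioo] at hI
        have h := ((hasDerivAt_id I).add
          ((hasDerivAt_actionDeriv hbd ε (T (ε, θ₂, I₂)) I).const_mul ε)).deriv
        rw [← angleDeriv_actionDeriv hF] at h
        refine lt_of_lt_of_eq ?_ h.symm
        linarith [(abs_le.1 (s3 ε hε (T (ε, θ₂, I₂)) I hI)).1]
    obtain rfl : I₁ = I₂ := hmono.injOn h₁ h₂ hI
    have k₁ := (hT' ε hε θ₁ I₁ h₁).2
    have k₂ := (hT' ε hε θ₂ I₁ h₁).2
    rw [ht] at k₁
    exact Prod.ext (k₁.symm.trans k₂) rfl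

/-- A function with nonvanishing derivative near zero agrees near zero with a global one. -/
theorem exists_contDiff_deriv_ne_zero {g : ℝ → ℝ} (hg : ContDiff ℝ (⊤ : ℕ∞) g) (hg0 : g 0 = 0)
    (hg' : deriv g 0 ≠ 0) : ∃ (η : ℝ) (G : ℝ → ℝ), 0 < η ∧ ContDiff ℝ (⊤ : ℕ∞) G ∧
      (∀ I, deriv G I ≠ 0) ∧ ∀ I, |I| ≤ η → G I = g I := by
  have hdg : ContDiff ℝ (⊤ : ℕ∞) (deriv g) := (contDiff_infty_iff_deriv.1 hg).2
  have hpos : ∀ᶠ I in nhds (0 : ℝ), 0 < deriv g I * deriv g 0 :=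
    (hdg.continuous.mul continuous_const).continuousAt.eventually_const_lt
      (by simpa using mul_self_pos.2 hg')
  obtain ⟨ρ, hρ, hball⟩ := Metric.eventually_nhds_iff.1 hpos
  let χ : ContDiffBump (0 : ℝ) := ⟨ρ / 3, ρ / 2, by linarith, by linarith⟩
  have hχ : ContDiff ℝ (⊤ : ℕ∞) χ := χ.contDiff
  set h : ℝ → ℝ := fun I => χ I * deriv g I + (1 - χ I) * deriv g 0
  have hh : ContDiff ℝ (⊤ : ℕ∞) h := by fun_prop
  have hhc := hh.continuous
  have hG : ∀ I, HasDerivAt (fun I => ∫ t in (0 : ℝ)..I, h t) (h I) I := fun I =>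
    intervalIntegral.integral_hasDerivAt_right (hhc.intervalIntegrable _ _)
      (hhc.stronglyMeasurableAtFilter _ _) hhc.continuousAt
  refine ⟨ρ / 3, fun I => ∫ t in (0 : ℝ)..I, h t, by linarith, ?_, fun I => ?_, fun I hI => ?_⟩
  · refine contDiff_infty_iff_deriv.2 ⟨fun I => (hG I).differentiableAt, ?_⟩
    rwa [show deriv (fun I => ∫ t in (0 : ℝ)..I, h t) = h from funext fun I => (hG I).deriv]
  · rw [(hG I).deriv]
    refine left_ne_zero_of_mul (b := deriv g 0) (ne_of_gt ?_)
    have e : h I * deriv g 0 = χ I * (deriv g I * deriv g 0) +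
        (1 - χ I) * (deriv g 0 * deriv g 0) := by ring
    rw [e]
    have h0 := mul_self_pos.2 hg'
    by_cases hI : dist I 0 < ρ
    · have h1 := hball hI
      rcases (χ.nonneg : 0 ≤ χ I).eq_or_lt with h2 | h2
      · rw [← h2]
        linarith
      · have h3 : 0 ≤ (1 - χ I) * (deriv g 0 * deriv g 0) :=
          mul_nonneg (sub_nonneg.2 χ.le_one) h0.le
        have h4 := mul_pos h2 h1
        linarith
    · have h1 : χ I = 0 := χ.zero_of_le_dist (by change ρ / 2 ≤ _; linarith)
      rw [h1]
      linarith
  · have e : ∫ t in (0 : ℝ)..I, h t = ∫ t in (0 : ℝ)..I, deriv g t := by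
      refine intervalIntegral.integral_congr fun t ht => ?_
      have h1 : |t| ≤ |I| := by simpa using abs_sub_left_of_mem_uIcc ht
      have h2 : χ t = 1 := χ.one_of_mem_closedBall (by
        change dist t 0 ≤ ρ / 3
        rw [Real.dist_0_eq_abs]
        exact h1.trans hI)
      simp [h, h2]
    change ∫ t in (0 : ℝ)..I, h t = g I
    rw [e, intervalIntegral.integral_deriv_eq_sub
      (fun t _ => (hg.differentiable (by simp)) t) (hdg.continuous.intervalIntegrable _ _), hg0,
      sub_zero]

/-- A periodic deformation is, after shrinking the domain, the restriction of a global one. -/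
theorem exists_contDiff_deformation {P : ℝ × ℝ × ℝ → ℝ} {p : ℝ → ℝ} {δ : ℝ} (hδ : 0 < δ)
    (hP : ContDiffOn ℝ (⊤ : ℕ∞) P (Ioo (-1) 1 ×ˢ univ ×ˢ Ioo (-δ) δ))
    (hPper : ∀ ε θ I, P (ε, θ + 2 * π, I) = P (ε, θ, I)) (hp : ContDiff ℝ (⊤ : ℕ∞) p)
    (hP0 : ∀ θ, ∀ I ∈ Ioo (-δ) δ, P (0, θ, I) = p I) :
    ∃ Q : ℝ × ℝ × ℝ → ℝ, ContDiff ℝ (⊤ : ℕ∞) Q ∧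
      (∀ ε θ I, Q (ε, θ + 2 * π, I) = Q (ε, θ, I)) ∧
      ∀ ε θ I, |ε| ≤ 1 / 2 → |I| ≤ δ / 3 → P (ε, θ, I) = p I + ε * Q (ε, θ, I) := by
  let χ : ContDiffBump (0 : ℝ) := ⟨δ / 3, δ / 2, by linarith, by linarith⟩
  let ψ : ContDiffBump (0 : ℝ) := ⟨1 / 2, 3 / 4, by norm_num, by norm_num⟩
  have hχ : ContDiff ℝ (⊤ : ℕ∞) χ := χ.contDiff
  have hψ : ContDiff ℝ (⊤ : ℕ∞) ψ := ψ.contDiff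
  have hχ0 : ∀ I, χ I ≠ 0 → |I| < δ / 2 := by
    intro I hI
    by_contra! h
    exact hI (χ.zero_of_le_dist (by rwa [Real.dist_0_eq_abs]))
  have hψ0 : ∀ I, ψ I ≠ 0 → |I| < 3 / 4 := by
    intro I hI
    by_contra! h
    exact hI (ψ.zero_of_le_dist (by rwa [Real.dist_0_eq_abs]))
  set c : ℝ × ℝ × ℝ → ℝ := fun z => ψ z.1 * χ z.2.2
  have hc : ContDiff ℝ (⊤ : ℕ∞) c :=
    (hψ.comp contDiff_fst).mul (hχ.comp (contDiff_snd.comp contDiff_snd))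
  have hsupp : tsupport c ⊆ Ioo (-1) 1 ×ˢ univ ×ˢ Ioo (-δ) δ := by
    have h1 : tsupport c ⊆ Icc (-(3 / 4)) (3 / 4) ×ˢ univ ×ˢ Icc (-(δ / 2)) (δ / 2) := by
      refine closure_minimal (fun z hz => ?_) (isClosed_Icc.prod (isClosed_univ.prod isClosed_Icc))
      exact ⟨abs_le.1 (hψ0 _ (left_ne_zero_of_mul hz)).le, mem_univ _,
        abs_le.1 (hχ0 _ (right_ne_zero_of_mul hz)).le⟩
    refine h1.trans (prod_mono (Icc_subset_Ioo ?_ ?_) (prod_mono subset_rfl (Icc_subset_Ioo ?_ ?_)))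
      <;> linarith
  have hR : ContDiff ℝ (⊤ : ℕ∞) fun z => c z * (P z - p z.2.2) :=
    contDiff_mul_of_tsupport_subset (isOpen_Ioo.prod (isOpen_univ.prod isOpen_Ioo)) hc
      (hP.sub (hp.comp (contDiff_snd.comp contDiff_snd)).contDiffOn) hsupp
  obtain ⟨Q, hQ, hQ'⟩ := exists_contDiff_eq_fst_mul hR (by
    rintro ⟨θ, I⟩
    by_cases h : χ I = 0
    · simp [c, h]
    · have h1 : I ∈ Ioo (-δ) δ := abs_lt.1 ((hχ0 I h).trans (by linarith))
      simp [hP0 θ I h1])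
  refine ⟨Q, hQ, fun ε θ I => ?_, fun ε θ I hε hI => ?_⟩
  · refine eq_of_fst_pow_mul_eq (N := 1) (x := (θ + 2 * π, I)) (y := (θ, I)) hQ.continuous
      (fun ε => ?_) ε
    have h1 := hQ' (ε, θ + 2 * π, I)
    rw [hPper] at h1
    rw [pow_one]
    exact h1.symm.trans (hQ' (ε, θ, I))
  · have h1 := hQ' (ε, θ, I)
    have h2 : ψ ε = 1 := ψ.one_of_mem_closedBall (by
      change dist ε 0 ≤ 1 / 2
      rwa [Real.dist_0_eq_abs])
    have h3 : χ I = 1 := χ.one_of_mem_closedBall (by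
      change dist I 0 ≤ δ / 3
      rwa [Real.dist_0_eq_abs])
    simp only [c, h2, h3] at h1
    linarith

/-- Birkhoff normal form for smooth deformations of the folded normal form
`p(θ, I) = b₀ + g(I)²` on the strip `ℝ × (−δ, δ)` (all data `2π`-periodic in `θ`):
in suitable symplectic coordinates the deformation equals
`b₀ + G(ε, I)² + ε·W(ε, θ)` up to an `O(ε^∞)` error. -/
theorem birkhoff_normal_form_deformation
    (δ b₀ : ℝ) (hδ : 0 < δ) (g : ℝ → ℝ)
    (hg : ContDiff ℝ (⊤ : ℕ∞) g) (hg0 : g 0 = 0)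
    (hg' : ∀ I ∈ Set.Ioo (-δ) δ, deriv g I ≠ 0)
    (P : ℝ × ℝ × ℝ → ℝ)
    (hP : ContDiffOn ℝ (⊤ : ℕ∞) P (Set.Ioo (-1 : ℝ) 1 ×ˢ Set.univ ×ˢ Set.Ioo (-δ) δ))
    (hPper : ∀ ε θ I : ℝ, P (ε, θ + 2 * π, I) = P (ε, θ, I))
    (hP0 : ∀ θ : ℝ, ∀ I ∈ Set.Ioo (-δ) δ, P (0, θ, I) = b₀ + (g I) ^ 2) :
    ∃ (ε₀ δ' : ℝ) (φ : ℝ × ℝ × ℝ → ℝ × ℝ) (G : ℝ × ℝ → ℝ) (W : ℝ × ℝ → ℝ),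
      0 < ε₀ ∧ 0 < δ' ∧ δ' ≤ δ ∧
      ContDiffOn ℝ (⊤ : ℕ∞) φ (Set.Ioo (-ε₀) ε₀ ×ˢ Set.univ ×ˢ Set.Ioo (-δ') δ') ∧
      ContDiffOn ℝ (⊤ : ℕ∞) G (Set.Ioo (-ε₀) ε₀ ×ˢ Set.Ioo (-δ') δ') ∧
      ContDiffOn ℝ (⊤ : ℕ∞) W (Set.Ioo (-ε₀) ε₀ ×ˢ (Set.univ : Set ℝ)) ∧
      (∀ ε θ : ℝ, W (ε, θ + 2 * π) = W (ε, θ)) ∧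
      -- (i): each `φ_ε` is a symplectic change of variables of the strip
      (∀ ε ∈ Set.Ioo (-ε₀) ε₀,
        (∀ θ : ℝ, ∀ I ∈ Set.Ioo (-δ') δ',
          φ (ε, θ + 2 * π, I) = φ (ε, θ, I) + (2 * π, 0)) ∧
        Set.InjOn (fun z : ℝ × ℝ => φ (ε, z.1, z.2))
          (Set.Ico 0 (2 * π) ×ˢ Set.Ioo (-δ') δ') ∧
        (∀ θ : ℝ, ∀ I ∈ Set.Ioo (-δ') δ',
          (φ (ε, θ, I)).2 ∈ Set.Ioo (-δ) δ ∧
          (fderiv ℝ (fun z : ℝ × ℝ => φ (ε, z.1, z.2)) (θ, I)).det = 1)) ∧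
      -- (ii)
      (∀ θ : ℝ, ∀ I ∈ Set.Ioo (-δ') δ', φ (0, θ, I) = (θ, I)) ∧
      -- (iii)
      (∀ I ∈ Set.Ioo (-δ') δ', G (0, I) = g I) ∧
      (∀ ε ∈ Set.Ioo (-ε₀) ε₀, G (ε, 0) = 0) ∧
      -- (iv): O(ε^∞) remainder, uniformly on compact subsets of the strip
      (∀ N : ℕ, ∀ K : Set (ℝ × ℝ), IsCompact K →
        K ⊆ (Set.univ : Set ℝ) ×ˢ Set.Ioo (-δ') δ' →
        ∃ C > 0, ∀ θ I ε : ℝ, (θ, I) ∈ K → |ε| < ε₀ →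
          |P (ε, (φ (ε, θ, I)).1, (φ (ε, θ, I)).2) - b₀ - (G (ε, I)) ^ 2 - ε * W (ε, θ)|
            ≤ C * |ε| ^ N) := by
  obtain ⟨η, g₁, hη, hg₁, hg₁', hgg⟩ := exists_contDiff_deriv_ne_zero hg hg0
    (hg' 0 ⟨by linarith, hδ⟩)
  obtain ⟨Q, hQ, hQper, hPQ⟩ := exists_contDiff_deformation hδ hP hPper
    (p := fun I => b₀ + g I ^ 2) (by fun_prop) hP0
  obtain ⟨S, hS, hS0⟩ := exists_isApproxSolution_forall hg₁
    ((hgg 0 (by simpa using hη.le)).trans hg0) hg₁' hQ hQper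
  obtain ⟨F, Γ, W⟩ := S
  have hF : ContDiff ℝ (⊤ : ℕ∞) F := (hS 0).contDiff_fst
  have hΓ : ContDiff ℝ (⊤ : ℕ∞) Γ := (hS 0).contDiff_snd_fst
  have hW : ContDiff ℝ (⊤ : ℕ∞) W := (hS 0).contDiff_snd_snd
  have hb := contDiff_angleDeriv hF
  have hm : 0 < min η (δ / 3) := lt_min hη (by linarith)
  set d := min η (δ / 3) / 2 with hd_def
  have hd : 0 < d := by linarith
  have hdη : 2 * d ≤ η := by linarith [min_le_left η (δ / 3)]
  have hdδ : 2 * d ≤ δ / 3 := by linarith [min_le_right η (δ / 3)]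
  obtain ⟨c, hc⟩ := (hS 0).quasiperiodic
  have hbper := angleDeriv_add_two_pi (hF.differentiable (by simp)) hc
  obtain ⟨ε₀, T, hε₀, hε₀1, hT, hT'⟩ := exists_symplectic_of_generating hF hc hd
  have hact : ∀ ε ∈ Ioo (-ε₀) ε₀, ∀ θ, ∀ I ∈ Ioo (-d) d,
      |I + ε * angleDeriv F (ε, T (ε, θ, I), I)| < 2 * d := by
    intro ε hε θ I hI
    obtain ⟨-, -, -, h, -⟩ := (hT' ε hε).1 θ I hI
    linarith [abs_add_le I (ε * angleDeriv F (ε, T (ε, θ, I), I)), abs_lt.2 hI]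
  have h0 : (0 : ℝ) ∈ Ioo (-ε₀) ε₀ := ⟨by linarith, hε₀⟩
  have hid : ∀ I ∈ Ioo (-d) d, g₁ I = g I := fun I hI =>
    hgg I ((abs_lt.2 hI).le.trans (by linarith))
  refine ⟨ε₀, d, fun z => (T z, z.2.2 + z.1 * angleDeriv F (z.1, T z, z.2.2)),
    fun z => g₁ z.2 + z.1 * Γ z, W, hε₀, hd, by linarith, ?_, ?_, hW.contDiffOn, (hS 0).periodic,
    fun ε hε => ⟨fun θ I hI => ?_, (hT' ε hε).2.mono (prod_mono (subset_univ _) subset_rfl),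
      fun θ I hI => ⟨?_, ((hT' ε hε).1 θ I hI).2.2.2.2⟩⟩, fun θ I hI => ?_, fun I hI => ?_,
    fun ε _ => ?_, fun N K hK hKs => ?_⟩
  · have h1 : ContDiffOn ℝ (⊤ : ℕ∞) (fun z => angleDeriv F (z.1, T z, z.2.2))
        (Ioo (-ε₀) ε₀ ×ˢ univ ×ˢ Ioo (-d) d) := hb.comp_contDiffOn (by fun_prop)
    fun_prop
  · exact ContDiff.contDiffOn (by fun_prop)
  · simp only [((hT' ε hε).1 θ I hI).1, hbper]
    simp
  · exact abs_lt.1 ((hact ε hε θ I hI).trans_le (by linarith))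
  · have h1 := ((hT' 0 h0).1 θ I hI).2.1
    rw [zero_mul, add_zero] at h1
    simp [h1]
  · simp [hid I hI]
  · change g₁ 0 + ε * Γ (ε, 0) = 0
    have h1 : Γ (ε, 0) = 0 := hS0 ε
    rw [h1, hid 0 ⟨by linarith, hd⟩, hg0]
    simp
  · obtain ⟨r, hr, hdr⟩ := (hS N).defect_eq
    obtain ⟨M, hM⟩ := hK.isBounded.exists_norm_le
    obtain ⟨B, hB⟩ := ((isCompact_Icc (a := (-1 : ℝ)) (b := 1)).prod
      ((isCompact_Icc (a := -(M + 1)) (b := M + 1)).prod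
        (isCompact_Icc (a := -M) (b := M)))).exists_bound_of_continuousOn hr.continuous.continuousOn
    refine ⟨max B 1, by positivity, fun θ I ε hz hε => ?_⟩
    have hI : I ∈ Ioo (-d) d := (hKs hz).2
    have hε' : ε ∈ Ioo (-ε₀) ε₀ := abs_lt.1 hε
    have hε1 : |ε| ≤ 1 := by linarith
    have hMz : |θ| ≤ M ∧ |I| ≤ M := max_le_iff.1 (hM _ hz)
    obtain ⟨-, h2, h3, -, -⟩ := (hT' ε hε').1 θ I hI
    have h5 := hact ε hε' θ I hI
    set t := T (ε, θ, I)
    have ht : |t| ≤ M + 1 := by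
      have h4 : t = θ - ε * actionDeriv F (ε, t, I) := by linarith
      rw [h4]
      linarith [abs_sub θ (ε * actionDeriv F (ε, t, I))]
    have key : P (ε, t, I + ε * angleDeriv F (ε, t, I)) - b₀ - (g₁ I + ε * Γ (ε, I)) ^ 2 -
        ε * W (ε, θ) = ε ^ (N + 1) * r (ε, t, I) := by
      rw [← hdr (ε, t, I), hPQ ε t _ (by linarith) (by linarith),
        ← hgg (I + ε * angleDeriv F (ε, t, I)) (by linarith)]
      simp only [defect, h2]
      ring
    change |P (ε, t, I + ε * angleDeriv F (ε, t, I)) - b₀ - (g₁ I + ε * Γ (ε, I)) ^ 2 -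
        ε * W (ε, θ)| ≤ _
    rw [key, abs_mul, abs_pow, pow_succ, mul_comm]
    have hrB : |r (ε, t, I)| ≤ max B 1 :=
      (hB (ε, t, I) ⟨abs_le.1 hε1, abs_le.1 ht, abs_le.1 hMz.2⟩).trans (le_max_left _ _)
    exact mul_le_mul hrB (mul_le_of_le_one_right (by positivity) hε1) (by positivity)
      (by positivity)
end

section
/- Let h be a symbol on the strip ℝ × (−δ, δ). Then there exists a symbol a with {a, p} = h on all of ℝ × (−δ, δ) if and only if both of the following hold: (a) for every I ∈ (−δ, δ), the angular average vanishes: ∫₀^{2π} h(θ, I) dθ = 0; and (b) h vanishes on the well: h(θ, 0) = 0 for every θ ∈ ℝ. -/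
open Real Set

/-- The Poisson bracket of two functions of `(θ, I) ∈ ℝ²`:
`{a, b} = ∂_θ a · ∂_I b − ∂_I a · ∂_θ b`. -/
noncomputable def poissonBracket (a b : ℝ × ℝ → ℝ) (z : ℝ × ℝ) : ℝ :=
  fderiv ℝ a z (1, 0) * fderiv ℝ b z (0, 1) - fderiv ℝ a z (0, 1) * fderiv ℝ b z (1, 0)

/-- A symbol on the strip `ℝ × (−δ, δ)`: a smooth function, `2π`-periodic in `θ`. -/
def IsSymbol (δ : ℝ) (h : ℝ × ℝ → ℝ) : Prop :=
  ContDiffOn ℝ (⊤ : ℕ∞) h (Set.univ ×ˢ Set.Ioo (-δ) δ) ∧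
  ∀ θ I : ℝ, h (θ + 2 * π, I) = h (θ, I)

open MeasureTheory Topology Interval in
theorem hasFDerivAt_integral_of_contDiffOn {E F : Type*}
    [NormedAddCommGroup E] [NormedSpace ℝ E] [NormedAddCommGroup F] [NormedSpace ℝ F]
    {f : E × ℝ → F} {W : Set (E × ℝ)} (hW : IsOpen W) (hf : ContDiffOn ℝ 1 f W)
    {x₀ : E} (hx₀ : ∀ t ∈ Icc (0 : ℝ) 1, (x₀, t) ∈ W) :
    HasFDerivAt (fun x => ∫ t in (0 : ℝ)..1, f (x, t))
      (∫ t in (0 : ℝ)..1, (fderiv ℝ f (x₀, t)).comp (ContinuousLinearMap.inl ℝ E ℝ)) x₀ := by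
  set D : E × ℝ → E →L[ℝ] F :=
    fun z => (fderiv ℝ f z).comp (ContinuousLinearMap.inl ℝ E ℝ) with hD
  have hDc : ContinuousOn D W :=
    (hf.continuousOn_fderiv_of_isOpen hW le_rfl).clm_comp continuousOn_const
  have hslice : ∀ x : E, ContinuousOn (fun t : ℝ => (x, t)) (Icc 0 1) := fun x => by fun_prop
  obtain ⟨M, hM⟩ : ∃ M, ∀ t ∈ Icc (0 : ℝ) 1, ‖D (x₀, t)‖ ≤ M := by
    obtain ⟨M, hM⟩ := isCompact_Icc.exists_bound_of_continuousOn
      (hDc.comp (hslice x₀) (fun t ht => hx₀ t ht))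
    exact ⟨M, hM⟩
  have hopen : IsOpen (W ∩ (fun z => ‖D z‖) ⁻¹' Iio (M + 1)) :=
    hDc.norm.isOpen_inter_preimage hW isOpen_Iio
  obtain ⟨u, v, hu, -, hxu, hIv, huv⟩ := generalized_tube_lemma
    (isCompact_singleton (x := x₀)) (isCompact_Icc (a := (0 : ℝ)) (b := 1)) hopen (by
      rintro ⟨x, t⟩ ⟨hx, ht⟩
      obtain rfl : x = x₀ := hx
      exact ⟨hx₀ t ht, by simpa using (hM t ht).trans_lt (lt_add_one M)⟩)
  have hIoc : Ι (0 : ℝ) 1 ⊆ Icc 0 1 := by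
    rw [uIoc_of_le zero_le_one]
    exact Ioc_subset_Icc_self
  have hmem : ∀ x ∈ u, ∀ t ∈ Icc (0 : ℝ) 1, (x, t) ∈ W ∧ ‖D (x, t)‖ < M + 1 :=
    fun x hx t ht => huv ⟨hx, hIv ht⟩
  have hux : u ∈ 𝓝 x₀ := hu.mem_nhds (hxu rfl)
  have hfx : ∀ x ∈ u, ContinuousOn (fun t => f (x, t)) (Icc 0 1) := fun x hx =>
    hf.continuousOn.comp (hslice x) (fun t ht => (hmem x hx t ht).1)
  refine intervalIntegral.hasFDerivAt_integral_of_dominated_of_fderiv_le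
    (F := fun x t => f (x, t)) (F' := fun x t => D (x, t)) (bound := fun _ => M + 1)
    hux ?_ ?_ ?_ ?_ intervalIntegrable_const ?_
  · filter_upwards [hux] with x hx
    exact ((hfx x hx).mono hIoc).aestronglyMeasurable measurableSet_uIoc
  · apply ContinuousOn.intervalIntegrable
    rw [uIcc_of_le zero_le_one]
    exact hfx x₀ (hxu rfl)
  · exact ((hDc.comp (hslice x₀) (fun t ht => hx₀ t ht)).mono hIoc).aestronglyMeasurable
      measurableSet_uIoc
  · exact Filter.Eventually.of_forall fun t ht x hx => (hmem x hx t (hIoc ht)).2.le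
  · refine Filter.Eventually.of_forall fun t ht x hx => ?_
    have h1 : HasFDerivAt f (fderiv ℝ f (x, t)) (x, t) :=
      ((hf.contDiffAt (hW.mem_nhds (hmem x hx t (hIoc ht)).1)).differentiableAt
        one_ne_zero).hasFDerivAt
    exact h1.comp x (hasFDerivAt_prodMk_left x t)

theorem contDiffOn_integral_of_contDiffOn.{u} {E F : Type u}
    [NormedAddCommGroup E] [NormedSpace ℝ E] [NormedAddCommGroup F] [NormedSpace ℝ F]
    {f : E × ℝ → F} {W : Set (E × ℝ)} (hW : IsOpen W) (hf : ContDiffOn ℝ (⊤ : ℕ∞) f W)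
    {U : Set E} (hU : IsOpen U) (hUW : ∀ x ∈ U, ∀ t ∈ Icc (0 : ℝ) 1, (x, t) ∈ W) :
    ContDiffOn ℝ (⊤ : ℕ∞) (fun x => ∫ t in (0 : ℝ)..1, f (x, t)) U := by
  rw [contDiffOn_infty]
  intro n
  induction n generalizing F with
  | zero =>
    rw [Nat.cast_zero, contDiffOn_zero]
    exact fun x hx => (hasFDerivAt_integral_of_contDiffOn hW (hf.of_le (mod_cast le_top))
      (hUW x hx)).continuousAt.continuousWithinAt
  | succ n ih =>
    have hder := fun x hx => hasFDerivAt_integral_of_contDiffOn hW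
      (hf.of_le (mod_cast le_top)) (hUW x hx)
    rw [Nat.cast_add, Nat.cast_one, contDiffOn_succ_iff_fderiv_of_isOpen hU]
    refine ⟨fun x hx => (hder x hx).differentiableAt.differentiableWithinAt, by simp, ?_⟩
    refine ContDiffOn.congr (ih (f := fun z =>
      (fderiv ℝ f z).comp (ContinuousLinearMap.inl ℝ E ℝ)) ?_) (fun x hx => (hder x hx).fderiv)
    exact (((contDiffOn_infty_iff_fderiv_of_isOpen hW).1 hf).2).clm_comp contDiffOn_const

/-- The quotient of `f` by its second variable, as given by Hadamard's lemma. -/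
noncomputable def hadamardQuotient (f : ℝ × ℝ → ℝ) (z : ℝ × ℝ) : ℝ :=
  ∫ t in (0 : ℝ)..1, fderiv ℝ f (z.1, t * z.2) (0, 1)

theorem isOpen_strip (δ : ℝ) : IsOpen ((univ : Set ℝ) ×ˢ Ioo (-δ) δ) :=
  isOpen_univ.prod isOpen_Ioo

theorem mul_mem_Ioo_of_mem_Icc {δ I t : ℝ} (hI : I ∈ Ioo (-δ) δ) (ht : t ∈ Icc (0 : ℝ) 1) :
    t * I ∈ Ioo (-δ) δ := by
  rw [mem_Ioo, ← abs_lt] at hI ⊢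
  rw [abs_mul, abs_of_nonneg ht.1]
  exact (mul_le_of_le_one_left (abs_nonneg I) ht.2).trans_lt hI

theorem contDiffOn_hadamardQuotient {δ : ℝ} {f : ℝ × ℝ → ℝ}
    (hf : ContDiffOn ℝ (⊤ : ℕ∞) f (univ ×ˢ Ioo (-δ) δ)) :
    ContDiffOn ℝ (⊤ : ℕ∞) (hadamardQuotient f) (univ ×ˢ Ioo (-δ) δ) := by
  have hφ : ContDiff ℝ (⊤ : ℕ∞) (fun w : (ℝ × ℝ) × ℝ => (w.1.1, w.2 * w.1.2)) := by fun_prop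
  refine contDiffOn_integral_of_contDiffOn
    (f := fun w : (ℝ × ℝ) × ℝ => fderiv ℝ f (w.1.1, w.2 * w.1.2) (0, 1))
    ((isOpen_strip δ).preimage hφ.continuous) ?_ (isOpen_strip δ)
    (fun x hx t ht => ⟨mem_univ _, mul_mem_Ioo_of_mem_Icc hx.2 ht⟩)
  exact ((((contDiffOn_infty_iff_fderiv_of_isOpen (isOpen_strip δ)).1 hf).2).comp
    hφ.contDiffOn (fun w hw => hw)).clm_apply contDiffOn_const

theorem mul_hadamardQuotient {δ : ℝ} {f : ℝ × ℝ → ℝ}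
    (hf : ContDiffOn ℝ (⊤ : ℕ∞) f (univ ×ˢ Ioo (-δ) δ)) {θ I : ℝ} (hf0 : f (θ, 0) = 0)
    (hI : I ∈ Ioo (-δ) δ) : I * hadamardQuotient f (θ, I) = f (θ, I) := by
  have hmem : ∀ t ∈ Icc (0 : ℝ) 1, (θ, t * I) ∈ (univ : Set ℝ) ×ˢ Ioo (-δ) δ :=
    fun t ht => ⟨mem_univ _, mul_mem_Ioo_of_mem_Icc hI ht⟩
  have hder : ∀ t ∈ uIcc (0 : ℝ) 1, HasDerivAt (fun t => f (θ, t * I))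
      (I * fderiv ℝ f (θ, t * I) (0, 1)) t := by
    intro t ht
    rw [uIcc_of_le zero_le_one] at ht
    have h1 : HasFDerivAt f (fderiv ℝ f (θ, t * I)) (θ, t * I) :=
      ((hf.contDiffAt ((isOpen_strip δ).mem_nhds (hmem t ht))).differentiableAt
        (by simp)).hasFDerivAt
    have h2 : HasDerivAt (fun t : ℝ => (θ, t * I)) (0, I) t :=
      (hasDerivAt_const t θ).prodMk (by simpa using (hasDerivAt_id t).mul_const I)
    have h3 := h1.comp_hasDerivAt t h2
    have h4 : ((0, I) : ℝ × ℝ) = I • (0, 1) := by simp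
    rw [h4, map_smul, smul_eq_mul] at h3
    exact h3
  have hcont : ContinuousOn (fun t => I * fderiv ℝ f (θ, t * I) (0, 1)) (uIcc (0 : ℝ) 1) := by
    rw [uIcc_of_le zero_le_one]
    have hc := hf.continuousOn_fderiv_of_isOpen (isOpen_strip δ) (by simp)
    exact continuousOn_const.mul ((hc.comp (by fun_prop) hmem).clm_apply continuousOn_const)
  have h := intervalIntegral.integral_eq_sub_of_hasDerivAt hder hcont.intervalIntegrable
  rw [intervalIntegral.integral_const_mul] at h
  simpa [hadamardQuotient, hf0] using h

theorem fderiv_add_const_fst {f : ℝ × ℝ → ℝ} {c : ℝ} (hf : ∀ θ I, f (θ + c, I) = f (θ, I))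
    (θ I : ℝ) : fderiv ℝ f (θ + c, I) = fderiv ℝ f (θ, I) := by
  have h1 : (fun z => f (z + (c, 0))) = f := by
    ext ⟨x, y⟩
    simpa using hf x y
  have h2 := fderiv_comp_add_right (𝕜 := ℝ) (f := f) (x := (θ, I)) (c, 0)
  rw [h1] at h2
  simpa using h2.symm

theorem hasDerivAt_fst_of_contDiffOn {δ : ℝ} {f : ℝ × ℝ → ℝ}
    (hf : ContDiffOn ℝ (⊤ : ℕ∞) f (univ ×ˢ Ioo (-δ) δ)) (θ : ℝ) {I : ℝ} (hI : I ∈ Ioo (-δ) δ) :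
    HasDerivAt (fun θ => f (θ, I)) (fderiv ℝ f (θ, I) (1, 0)) θ := by
  have h1 : HasFDerivAt f (fderiv ℝ f (θ, I)) (θ, I) :=
    ((hf.contDiffAt ((isOpen_strip δ).mem_nhds ⟨mem_univ _, hI⟩)).differentiableAt
      (by simp)).hasFDerivAt
  exact h1.comp_hasDerivAt θ ((hasDerivAt_id θ).prodMk (hasDerivAt_const θ I))

theorem continuous_fst_of_contDiffOn {δ : ℝ} {f : ℝ × ℝ → ℝ}
    (hf : ContDiffOn ℝ (⊤ : ℕ∞) f (univ ×ˢ Ioo (-δ) δ)) {I : ℝ} (hI : I ∈ Ioo (-δ) δ) :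
    Continuous (fun θ => f (θ, I)) :=
  continuous_iff_continuousAt.2 fun θ => (hasDerivAt_fst_of_contDiffOn hf θ hI).continuousAt

/-- A symbol with vanishing angular averages has a primitive in `θ` that is a symbol and vanishes
wherever the symbol itself does. -/
theorem IsSymbol.exists_angular_primitive {δ : ℝ} {h : ℝ × ℝ → ℝ} (hh : IsSymbol δ h)
    (hav : ∀ I ∈ Ioo (-δ) δ, (∫ θ in (0 : ℝ)..(2 * π), h (θ, I)) = 0) :
    ∃ H : ℝ × ℝ → ℝ, IsSymbol δ H ∧
      (∀ θ : ℝ, ∀ I ∈ Ioo (-δ) δ, HasDerivAt (fun θ => H (θ, I)) (h (θ, I)) θ) ∧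
      ∀ I, (∀ θ, h (θ, I) = 0) → ∀ θ, H (θ, I) = 0 := by
  classical
  obtain ⟨hs, hper⟩ := hh
  set H : ℝ × ℝ → ℝ := fun z =>
    if z.2 ∈ Ioo (-δ) δ then ∫ s in (0 : ℝ)..z.1, h (s, z.2) else 0 with hH
  have hHI : ∀ θ : ℝ, ∀ I ∈ Ioo (-δ) δ, H (θ, I) = ∫ s in (0 : ℝ)..θ, h (s, I) :=
    fun θ I hI => if_pos hI
  refine ⟨H, ⟨?_, fun θ I => ?_⟩, fun θ I hI => ?_, fun I h0 θ => ?_⟩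
  · have hφ : ContDiff ℝ (⊤ : ℕ∞) (fun w : (ℝ × ℝ) × ℝ => (w.1.1 * w.2, w.1.2)) := by fun_prop
    have hsm := contDiffOn_integral_of_contDiffOn
      (f := fun w : (ℝ × ℝ) × ℝ => h (w.1.1 * w.2, w.1.2))
      ((isOpen_strip δ).preimage hφ.continuous) (hs.comp hφ.contDiffOn (fun w hw => hw))
      (isOpen_strip δ) (fun x hx t _ => ⟨mem_univ _, hx.2⟩)
    refine (contDiff_fst.contDiffOn.mul hsm).congr ?_
    rintro ⟨θ, I⟩ ⟨-, hI⟩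
    rw [hHI θ I hI]
    simpa using (intervalIntegral.mul_integral_comp_mul_left (a := 0) (b := 1)
      (f := fun s => h (s, I)) θ).symm
  · by_cases hI : I ∈ Ioo (-δ) δ
    · have hc := continuous_fst_of_contDiffOn hs hI
      have hp : Function.Periodic (fun s => h (s, I)) (2 * π) := fun s => hper s I
      rw [hHI _ I hI, hHI _ I hI, ← intervalIntegral.integral_add_adjacent_intervals
        (hc.intervalIntegrable 0 θ) (hc.intervalIntegrable θ (θ + 2 * π)),
        hp.intervalIntegral_add_eq θ 0, zero_add, hav I hI, add_zero]
    · exact (if_neg hI).trans (if_neg hI).symm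
  · have hc := continuous_fst_of_contDiffOn hs hI
    refine (hc.integral_hasStrictDerivAt 0 θ).hasDerivAt.congr_of_eventuallyEq ?_
    exact Filter.Eventually.of_forall fun x => hHI x I hI
  · simp [hH, h0]

theorem ne_zero_of_deriv_ne_zero {δ : ℝ} {g : ℝ → ℝ} (hg : Differentiable ℝ g) (hg0 : g 0 = 0)
    (hg' : ∀ I ∈ Ioo (-δ) δ, deriv g I ≠ 0) {I : ℝ} (hI : I ∈ Ioo (-δ) δ) (hI0 : I ≠ 0) :
    g I ≠ 0 := by
  intro hgI
  obtain ⟨hI1, hI2⟩ := hI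
  rcases hI0.lt_or_gt with hneg | hpos
  · obtain ⟨c, hc, hc'⟩ := exists_deriv_eq_zero hneg hg.continuous.continuousOn
      (hgI.trans hg0.symm)
    exact hg' c ⟨by linarith [hc.1], by linarith [hc.2]⟩ hc'
  · obtain ⟨c, hc, hc'⟩ := exists_deriv_eq_zero hpos hg.continuous.continuousOn
      (hg0.trans hgI.symm)
    exact hg' c ⟨by linarith [hc.1], by linarith [hc.2]⟩ hc'

theorem poissonBracket_const_add_sq {g : ℝ → ℝ} (hg : Differentiable ℝ g) {b₀ : ℝ}
    {p : ℝ × ℝ → ℝ} (hp : ∀ θ I : ℝ, p (θ, I) = b₀ + (g I) ^ 2) (a : ℝ × ℝ → ℝ) (θ I : ℝ) :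
    poissonBracket a p (θ, I) = fderiv ℝ a (θ, I) (1, 0) * (2 * g I * deriv g I) := by
  have hpe : p = (fun x => b₀ + g x ^ 2) ∘ Prod.snd := funext fun z => hp z.1 z.2
  have h1 : HasDerivAt (fun x => b₀ + g x ^ 2) (2 * g I * deriv g I) I := by
    simpa using ((hg I).hasDerivAt.pow 2).const_add b₀
  have h2 : HasFDerivAt p _ (θ, I) :=
    hpe ▸ h1.hasFDerivAt.comp (θ, I) (hasFDerivAt_snd (𝕜 := ℝ) (p := (θ, I)))
  simp [poissonBracket, h2.fderiv]

/-- A symbol `h` on the strip is of the form `{a, p}` for a symbol `a` (with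
`p = b₀ + g(I)²`) if and only if its angular averages vanish and it vanishes on the
well `{I = 0}`. -/
theorem range_of_ad_p
    (δ b₀ : ℝ) (hδ : 0 < δ) (g : ℝ → ℝ)
    (hg : ContDiff ℝ (⊤ : ℕ∞) g) (hg0 : g 0 = 0)
    (hg' : ∀ I ∈ Set.Ioo (-δ) δ, deriv g I ≠ 0)
    (p : ℝ × ℝ → ℝ) (hp : ∀ θ I : ℝ, p (θ, I) = b₀ + (g I) ^ 2)
    (h : ℝ × ℝ → ℝ) (hh : IsSymbol δ h) :
    (∃ a : ℝ × ℝ → ℝ, IsSymbol δ a ∧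
      ∀ θ : ℝ, ∀ I ∈ Set.Ioo (-δ) δ, poissonBracket a p (θ, I) = h (θ, I)) ↔
    ((∀ I ∈ Set.Ioo (-δ) δ, (∫ θ in (0:ℝ)..(2 * π), h (θ, I)) = 0) ∧
      (∀ θ : ℝ, h (θ, 0) = 0)) := by
  have hgd : Differentiable ℝ g := hg.differentiable (by simp)
  have h0 : (0 : ℝ) ∈ Ioo (-δ) δ := ⟨by linarith, hδ⟩
  simp only [poissonBracket_const_add_sq hgd hp]
  constructor
  · rintro ⟨a, ⟨has, haper⟩, heq⟩
    refine ⟨fun I hI => ?_, fun θ => by rw [← heq θ 0 h0, hg0]; ring⟩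
    have hder : ∀ θ ∈ uIcc (0 : ℝ) (2 * π),
        HasDerivAt (fun θ => a (θ, I) * (2 * g I * deriv g I)) (h (θ, I)) θ := fun θ _ =>
      heq θ I hI ▸ (hasDerivAt_fst_of_contDiffOn has θ hI).mul_const _
    rw [intervalIntegral.integral_eq_sub_of_hasDerivAt hder
      ((continuous_fst_of_contDiffOn hh.1 hI).intervalIntegrable _ _)]
    have hper := haper 0 I
    rw [zero_add] at hper
    rw [hper, sub_self]
  · rintro ⟨hav, hwell⟩
    obtain ⟨H, ⟨hHs, hHper⟩, hHder, hH0⟩ := hh.exists_angular_primitive hav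
    have hgs : ContDiffOn ℝ (⊤ : ℕ∞) (fun z : ℝ × ℝ => g z.2) (univ ×ˢ Ioo (-δ) δ) :=
      (hg.comp contDiff_snd).contDiffOn
    set Q := hadamardQuotient H
    set G : ℝ → ℝ := fun I => hadamardQuotient (fun z : ℝ × ℝ => g z.2) (0, I) with hG
    have hQs : ContDiffOn ℝ (⊤ : ℕ∞) Q (univ ×ˢ Ioo (-δ) δ) := contDiffOn_hadamardQuotient hHs
    have hGs : ContDiffOn ℝ (⊤ : ℕ∞) (fun z : ℝ × ℝ => G z.2) (univ ×ˢ Ioo (-δ) δ) :=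
      (contDiffOn_hadamardQuotient hgs).comp (t := univ ×ˢ Ioo (-δ) δ)
        (f := fun z : ℝ × ℝ => ((0 : ℝ), z.2))
        (by fun_prop) (fun z hz => ⟨mem_univ _, hz.2⟩)
    have hIG : ∀ I ∈ Ioo (-δ) δ, I * G I = g I := fun I hI =>
      mul_hadamardQuotient (θ := 0) hgs hg0 hI
    have hG0 : ∀ I ∈ Ioo (-δ) δ, G I ≠ 0 := by
      intro I hI
      rcases eq_or_ne I 0 with rfl | hI0
      · have h2 : HasFDerivAt (fun z : ℝ × ℝ => g z.2) _ ((0 : ℝ), (0 : ℝ)) :=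
          (hgd 0).hasDerivAt.hasFDerivAt.comp ((0 : ℝ), (0 : ℝ))
            (hasFDerivAt_snd (𝕜 := ℝ) (p := ((0 : ℝ), (0 : ℝ))))
        have hval : G 0 = deriv g 0 := by simp [hG, hadamardQuotient, h2.fderiv]
        exact hval ▸ hg' 0 h0
      · exact fun hGI => ne_zero_of_deriv_ne_zero hgd hg0 hg' hI hI0
          (by rw [← hIG I hI, hGI, mul_zero])
    have hg's : ContDiff ℝ (⊤ : ℕ∞) (deriv g) := (contDiff_infty_iff_deriv.1 hg).2
    have has : ContDiffOn ℝ (⊤ : ℕ∞) (fun z : ℝ × ℝ => Q z / (2 * G z.2 * deriv g z.2))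
        (univ ×ˢ Ioo (-δ) δ) :=
      hQs.div ((contDiffOn_const.mul hGs).mul (hg's.comp contDiff_snd).contDiffOn)
        fun z hz => mul_ne_zero (mul_ne_zero two_ne_zero (hG0 _ hz.2)) (hg' _ hz.2)
    refine ⟨_, ⟨has, fun θ I => ?_⟩, fun θ I hI => ?_⟩
    · simp only [Q, hadamardQuotient, fderiv_add_const_fst hHper]
    · have hQ := hasDerivAt_fst_of_contDiffOn hQs θ hI
      have hIQ : I * fderiv ℝ Q (θ, I) (1, 0) = h (θ, I) := by
        refine (hQ.const_mul I).unique ((hHder θ I hI).congr_of_eventuallyEq ?_)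
        exact Filter.Eventually.of_forall fun x =>
          mul_hadamardQuotient hHs (hH0 0 hwell x) hI
      rw [(hasDerivAt_fst_of_contDiffOn has θ hI).unique (hQ.div_const (2 * G I * deriv g I)),
        ← hIQ, ← hIG I hI]
      have hGI := hG0 I hI
      have hgI := hg' I hI
      field_simp
end
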